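/- arXiv:2404.00296 — 5 statements merged into one kernel-verified Lean document; each statement's English description precedes it below -/
import Mathlib

section
/- Let A be a Banach algebra that is a two-sided ideal in its bidual A** (with the first Arens product) and has a bounded approximate identity with associated mixed identity e ∈ A**. Let J be a closed ideal of A and i* : A* → J* the restriction map adjoint to the inclusion i : J → A. Then the identities m = em + (m − em) and m = m◊e + (m − m◊e) give internal direct sum decompositions J** = eJ** ⊕ i*(WAP(A))^⊥ and J** = J**◊e ⊕ i*(WAP(A))^⊥, where i*(WAP(A))^⊥ = {r ∈ J** : ⟨r, i*(φ)⟩ = 0 for all φ ∈ WAP(A)}. Moreover J**·i*(WAP(A))^⊥ = {0} (first Arens product), i*(WAP(A))^⊥◊J** = {0} (second Arens product), and i*(WAP(A))^⊥ is a closed two-sided ideal of J** for both Arens products. -/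
noncomputable section

open Filter Topology

section ArensSetup

variable (A : Type*) [NonUnitalNormedRing A] [NormedSpace ℂ A]
  [IsScalarTower ℂ A A] [SMulCommClass ℂ A A]

/-- The module action `φ · a` of `A` on `A*`: `⟨φ · a, b⟩ = ⟨φ, a * b⟩`. -/
def dArR (φ : A →L[ℂ] ℂ) (a : A) : A →L[ℂ] ℂ :=
  φ.comp (ContinuousLinearMap.mul ℂ A a)

/-- The module action `a · φ` of `A` on `A*`: `⟨a · φ, b⟩ = ⟨φ, b * a⟩`. -/
def dArL (a : A) (φ : A →L[ℂ] ℂ) : A →L[ℂ] ℂ :=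
  φ.comp ((ContinuousLinearMap.mul ℂ A).flip a)

/-- `φ ↦ (a ↦ φ · a)`, bundled as a continuous linear map. -/
def dArRL : (A →L[ℂ] ℂ) →L[ℂ] A →L[ℂ] A →L[ℂ] ℂ :=
  ((ContinuousLinearMap.compL ℂ A (A →L[ℂ] A) (A →L[ℂ] ℂ)).flip
      (ContinuousLinearMap.mul ℂ A)).comp (ContinuousLinearMap.compL ℂ A A ℂ)

/-- `φ ↦ (a ↦ a · φ)`, bundled as a continuous linear map. -/
def dArLL : (A →L[ℂ] ℂ) →L[ℂ] A →L[ℂ] A →L[ℂ] ℂ :=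
  ((ContinuousLinearMap.compL ℂ A (A →L[ℂ] A) (A →L[ℂ] ℂ)).flip
      ((ContinuousLinearMap.mul ℂ A).flip)).comp (ContinuousLinearMap.compL ℂ A A ℂ)

/-- The module action `m · φ` of `A**` on `A*`: `⟨m · φ, a⟩ = ⟨m, φ · a⟩`. -/
def bdF (m : (A →L[ℂ] ℂ) →L[ℂ] ℂ) (φ : A →L[ℂ] ℂ) : A →L[ℂ] ℂ :=
  m.comp (dArRL A φ)

/-- The module action `φ · m` of `A**` on `A*`: `⟨φ · m, a⟩ = ⟨m, a · φ⟩`. -/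
def fBd (φ : A →L[ℂ] ℂ) (m : (A →L[ℂ] ℂ) →L[ℂ] ℂ) : A →L[ℂ] ℂ :=
  m.comp (dArLL A φ)

/-- The first Arens product on `A**`: `⟨m n, φ⟩ = ⟨m, n · φ⟩`. -/
def ar1 (m n : (A →L[ℂ] ℂ) →L[ℂ] ℂ) : (A →L[ℂ] ℂ) →L[ℂ] ℂ :=
  m.comp ((ContinuousLinearMap.compL ℂ A (A →L[ℂ] ℂ) ℂ n).comp (dArRL A))

/-- The second Arens product on `A**`: `⟨m ◊ n, φ⟩ = ⟨n, φ · m⟩`. -/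
def ar2 (m n : (A →L[ℂ] ℂ) →L[ℂ] ℂ) : (A →L[ℂ] ℂ) →L[ℂ] ℂ :=
  n.comp ((ContinuousLinearMap.compL ℂ A (A →L[ℂ] ℂ) ℂ m).comp (dArLL A))

/-- The canonical embedding of `A` into its bidual. -/
def ιA : A →L[ℂ] ((A →L[ℂ] ℂ) →L[ℂ] ℂ) := ContinuousLinearMap.apply ℂ ℂ

/-- The set of weakly almost periodic functionals: those `φ ∈ A*` for which `a ↦ a · φ`
is a weakly compact operator from `A` to `A*`. -/
def WAPset : Set (A →L[ℂ] ℂ) :=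
  {φ | IsCompact (closure
    ((fun a : A => (show WeakSpace ℂ (A →L[ℂ] ℂ) from dArL A a φ)) '' Metric.closedBall 0 1))}

/-- `u` is a bounded (two-sided) approximate identity along the filter `l`. -/
def IsBAIFor {ιt : Type*} (l : Filter ιt) (u : ιt → A) : Prop :=
  l.NeBot ∧ Bornology.IsBounded (Set.range u) ∧
    (∀ a : A, Tendsto (fun i => a * u i) l (𝓝 a)) ∧
    (∀ a : A, Tendsto (fun i => u i * a) l (𝓝 a))

/-- `A` has a bounded approximate identity. -/
def HasBAI : Prop := ∃ (ιt : Type) (l : Filter ιt) (u : ιt → A), IsBAIFor A l u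

/-- A mixed identity of `A**`: a right identity for the first Arens product and a left
identity for the second Arens product. -/
def IsMixedIdentity (e : (A →L[ℂ] ℂ) →L[ℂ] ℂ) : Prop :=
  (∀ m, ar1 A m e = m) ∧ (∀ m, ar2 A e m = m)

/-- `A` is a two-sided ideal in its bidual (with the first Arens product). -/
def IdealInBidual : Prop :=
  ∀ (m : (A →L[ℂ] ℂ) →L[ℂ] ℂ) (a : A),
    ar1 A m (ιA A a) ∈ Set.range (ιA A) ∧ ar1 A (ιA A a) m ∈ Set.range (ιA A)

/-- `A` is weakly sequentially complete. -/
def WeaklySequentiallyComplete : Prop :=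
  ∀ x : ℕ → A, (∀ φ : A →L[ℂ] ℂ, ∃ z : ℂ, Tendsto (fun n => φ (x n)) atTop (𝓝 z)) →
    ∃ a : A, ∀ φ : A →L[ℂ] ℂ, Tendsto (fun n => φ (x n)) atTop (𝓝 (φ a))

/-- The wsaBAI class: weakly sequentially complete, with a bounded approximate identity,
and an ideal in its bidual. -/
def IsWSABAI : Prop :=
  WeaklySequentiallyComplete A ∧ HasBAI A ∧ IdealInBidual A

/-- `J` is a closed two-sided ideal of `A`. -/
def IsClosedIdeal (J : Submodule ℂ A) : Prop :=
  IsClosed (J : Set A) ∧ (∀ b : A, ∀ a ∈ J, b * a ∈ J) ∧ (∀ b : A, ∀ a ∈ J, a * b ∈ J)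

/-- The canonical image `J^{⊥⊥}` of `J**` inside `A**`.  For a closed ideal `J` this
realizes the bidual of `J` (with its Arens products) inside `A**`. -/
def bidualOf (J : Submodule ℂ A) : Set ((A →L[ℂ] ℂ) →L[ℂ] ℂ) :=
  {s | ∀ φ : A →L[ℂ] ℂ, (∀ a ∈ J, φ a = 0) → s φ = 0}

/-- The first topological centre of a subset of `A**` (e.g. of `J** = bidualOf A J`). -/
def Z1in (S : Set ((A →L[ℂ] ℂ) →L[ℂ] ℂ)) : Set ((A →L[ℂ] ℂ) →L[ℂ] ℂ) :=
  {m ∈ S | ∀ n ∈ S, ar1 A m n = ar2 A m n}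

/-- The second topological centre of a subset of `A**`. -/
def Z2in (S : Set ((A →L[ℂ] ℂ) →L[ℂ] ℂ)) : Set ((A →L[ℂ] ℂ) →L[ℂ] ℂ) :=
  {m ∈ S | ∀ n ∈ S, ar1 A n m = ar2 A n m}

/-- The restriction map `i* : A* → J*` adjoint to the inclusion `i : J → A`. -/
def iStar (J : Submodule ℂ A) : (A →L[ℂ] ℂ) →L[ℂ] (↥J →L[ℂ] ℂ) :=
  (ContinuousLinearMap.compL ℂ ↥J A ℂ).flip J.subtypeL

/-- `i*(WAP(A))^⊥ = {r ∈ J** : ⟨r, i*(φ)⟩ = 0 for all φ ∈ WAP(A)}`, realized inside `A**`. -/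
def wapPerp (J : Submodule ℂ A) : Set ((A →L[ℂ] ℂ) →L[ℂ] ℂ) :=
  {r ∈ bidualOf A J | ∀ φ ∈ WAPset A, r φ = 0}

/-- `J` is a weak Riesz ideal: `J** · J* ∪ J* · J**` is contained in the norm closure
of `i*(WAP(A))` in `J*`. -/
def WeakRiesz (J : Submodule ℂ A) : Prop :=
  ∀ m ∈ bidualOf A J, ∀ ψ : A →L[ℂ] ℂ,
    iStar A J (bdF A m ψ) ∈ closure (iStar A J '' WAPset A) ∧
    iStar A J (fBd A ψ m) ∈ closure (iStar A J '' WAPset A)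

/-- `J` is a small-1-1 ideal: `e J** J** ⊆ J`. -/
def Small11 (J : Submodule ℂ A) (e : (A →L[ℂ] ℂ) →L[ℂ] ℂ) : Prop :=
  ∀ m ∈ bidualOf A J, ∀ n ∈ bidualOf A J,
    ar1 A e (ar1 A m n) ∈ ιA A '' (J : Set A)

/-- `J` is a Riesz ideal: `e J** = J** ◊ e = J`. -/
def RieszIdeal (J : Submodule ℂ A) (e : (A →L[ℂ] ℂ) →L[ℂ] ℂ) : Prop :=
  {s | ∃ m ∈ bidualOf A J, s = ar1 A e m} = ιA A '' (J : Set A) ∧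
  {s | ∃ m ∈ bidualOf A J, s = ar2 A m e} = ιA A '' (J : Set A)

/-- `J` has a bounded approximate identity (as a Banach algebra in its own right). -/
def HasBAIinIdeal (J : Submodule ℂ A) : Prop :=
  ∃ (ιt : Type) (l : Filter ιt) (u : ιt → A), l.NeBot ∧ Bornology.IsBounded (Set.range u) ∧
    (∀ i, u i ∈ J) ∧ (∀ a ∈ J, Tendsto (fun i => a * u i) l (𝓝 a)) ∧
    (∀ a ∈ J, Tendsto (fun i => u i * a) l (𝓝 a))

/-- `WAP(J)` as a subset of `J*`: those `ξ ∈ J*` such that `b ↦ b · ξ` is a weakly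
compact operator from `J` to `J*`.  The action is computed through any Hahn–Banach
extension `ψ ∈ A*` of `ξ` (for an ideal `J` the result does not depend on the extension). -/
def WAPJ (J : Submodule ℂ A) : Set (↥J →L[ℂ] ℂ) :=
  {ξ | ∃ ψ : A →L[ℂ] ℂ, iStar A J ψ = ξ ∧
    IsCompact (closure
      ((fun b : ↥J => (show WeakSpace ℂ (↥J →L[ℂ] ℂ) from iStar A J (dArL A (b : A) ψ))) ''
        Metric.closedBall 0 1))}

end ArensSetup

section ArensLemmas

open ContinuousLinearMap

/-- A point that no functional of the dual pair `B` separates from the image under `g` of a convex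
set `s` is a limit of `g`, in the weak topology of `B`, along an ultrafilter containing `s`. -/
theorem exists_ultrafilter_tendsto_of_convex {E V F : Type*} [AddCommGroup E] [Module ℝ E]
    [AddCommGroup V] [Module ℂ V] [Module ℝ V] [IsScalarTower ℝ ℂ V] [AddCommGroup F] [Module ℂ F]
    (B : V →ₗ[ℂ] F →ₗ[ℂ] ℂ) (g : E →ₗ[ℝ] V) {s : Set E} (hs : Convex ℝ s) (x : V)
    (hx : ∀ (y : F) (u : ℝ), (∀ a ∈ s, (B (g a) y).re < u) → (B x y).re ≤ u) :
    ∃ l : Ultrafilter E, s ∈ l ∧ ∀ y, Tendsto (fun a => B (g a) y) l (𝓝 (B x y)) := by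
  let g' : E → WeakBilin B := g
  let x' : WeakBilin B := x
  have hmem : x' ∈ closure (g' '' s) := by
    by_contra hmem
    have hsmul := IsScalarTower.continuousSMul (M := ℝ) (α := WeakBilin B) ℂ
    have hconv : Convex ℝ (g' '' s) := hs.linear_image g
    obtain ⟨f, u, hlt, hu⟩ := RCLike.geometric_hahn_banach_closed_point (𝕜 := ℂ)
      hconv.closure isClosed_closure hmem
    obtain ⟨y, rfl⟩ := LinearMap.dualEmbedding_surjective B f
    exact (hx y u fun a ha => hlt _ (subset_closure ⟨a, ha, rfl⟩)).not_gt hu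
  have hne : (comap g' (𝓝 x') ⊓ 𝓟 s).NeBot := by
    rw [← map_neBot_iff g', Filter.push_pull', map_principal]
    exact mem_closure_iff_clusterPt.mp hmem
  have hg : Tendsto g' (Ultrafilter.of (comap g' (𝓝 x') ⊓ 𝓟 s) : Filter E) (𝓝 x') :=
    tendsto_iff_comap.mpr ((Ultrafilter.of_le _).trans inf_le_left)
  exact ⟨Ultrafilter.of _, Ultrafilter.of_le _ (mem_inf_of_right (mem_principal_self _)),
    fun y => ((WeakBilin.eval_continuous B y).tendsto _).comp hg⟩

/-- **Goldstine's theorem**: every element of the unit ball of the bidual of a normed space is a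
weak-star limit along an ultrafilter containing the unit ball of the space. -/
theorem exists_ultrafilter_tendsto_bidual {E : Type*} [NormedAddCommGroup E]
    [NormedSpace ℂ E] (n : (E →L[ℂ] ℂ) →L[ℂ] ℂ) (hn : ‖n‖ ≤ 1) :
    ∃ l : Ultrafilter E, Metric.closedBall 0 1 ∈ l ∧
      ∀ φ : E →L[ℂ] ℂ, Tendsto φ l (𝓝 (n φ)) := by
  refine exists_ultrafilter_tendsto_of_convex (coeLM ℂ)
    ((ContinuousLinearMap.apply ℂ ℂ : E →L[ℂ] (E →L[ℂ] ℂ) →L[ℂ] ℂ).toLinearMap.restrictScalars ℝ)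
    (convex_closedBall 0 1) n fun φ u hu => ?_
  have hre : ∀ a : E, ‖a‖ ≤ 1 → (φ a).re < u := fun a ha => hu a (by simpa using ha)
  have hu0 : 0 < u := by simpa using hre 0 (by simp)
  have hφ : ‖φ‖ ≤ u := by
    refine opNorm_le_of_unit_norm hu0.le fun a ha => ?_
    obtain ⟨c, hc, hca⟩ := RCLike.exists_norm_eq_mul_self (φ a)
    have hlt := hre (c • a) (by rw [norm_smul, hc, ha, one_mul])
    rw [map_smul, smul_eq_mul, ← hca] at hlt
    exact hlt.le
  calc (n φ).re ≤ ‖n φ‖ := Complex.re_le_norm _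
    _ ≤ 1 * ‖φ‖ := n.le_of_opNorm_le hn φ
    _ ≤ u := by rwa [one_mul]

variable {A : Type*} [NonUnitalNormedRing A] [NormedSpace ℂ A]
  [IsScalarTower ℂ A A] [SMulCommClass ℂ A A]

theorem ar1_apply_eq_ar2_apply_of_mem_WAPset {φ : A →L[ℂ] ℂ} (hφ : φ ∈ WAPset A)
    (m n : (A →L[ℂ] ℂ) →L[ℂ] ℂ) : ar1 A m n φ = ar2 A m n φ := by
  wlog hn : ‖n‖ ≤ 1 generalizing n
  · have hc : (‖n‖ : ℂ)⁻¹ ≠ 0 := by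
      simp only [ne_eq, inv_eq_zero, Complex.ofReal_eq_zero]
      intro h
      simp [h] at hn
    have hsmul := this ((‖n‖ : ℂ)⁻¹ • n) (by
      refine (opNorm_smul_le _ _).trans ?_
      rw [norm_inv, Complex.norm_real, Real.norm_of_nonneg (norm_nonneg n)]
      exact inv_mul_le_one)
    have h1 : ar1 A m ((‖n‖ : ℂ)⁻¹ • n) φ = (‖n‖ : ℂ)⁻¹ • ar1 A m n φ :=
      m.map_smul _ (bdF A n φ)
    have h2 : ar2 A m ((‖n‖ : ℂ)⁻¹ • n) φ = (‖n‖ : ℂ)⁻¹ • ar2 A m n φ := rfl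
    rw [h1, h2] at hsmul
    exact smul_right_injective ℂ hc hsmul
  obtain ⟨F, hF, hFn⟩ := exists_ultrafilter_tendsto_bidual n hn
  let T : A → WeakSpace ℂ (A →L[ℂ] ℂ) := fun a => toWeakSpace ℂ (A →L[ℂ] ℂ) (dArL A a φ)
  obtain ⟨ψ, -, hψ⟩ := isCompact_iff_ultrafilter_le_nhds'.mp hφ (F.map T)
    (mem_of_superset (image_mem_map hF) subset_closure)
  have hlim : ∀ k : (A →L[ℂ] ℂ) →L[ℂ] ℂ,
      Tendsto (fun a => k (dArL A a φ)) F (𝓝 (k ((toWeakSpace ℂ (A →L[ℂ] ℂ)).symm ψ))) :=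
    fun k => ((WeakBilin.eval_continuous (topDualPairing ℂ (A →L[ℂ] ℂ)).flip k).tendsto
      ψ).comp hψ
  have hψn : (toWeakSpace ℂ (A →L[ℂ] ℂ)).symm ψ = bdF A n φ :=
    ContinuousLinearMap.ext fun a =>
      tendsto_nhds_unique (hlim (ιA A a)) (hFn (dArR A φ a))
  have h2 := tendsto_nhds_unique (hlim m) (hFn (fBd A φ m))
  rw [hψn] at h2
  exact h2

theorem dArL_mem_WAPset (hIdeal : IdealInBidual A) (a : A) (φ : A →L[ℂ] ℂ) :
    dArL A a φ ∈ WAPset A := by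
  choose k hk using fun m => (hIdeal m a).1
  have hk' : ∀ (m : (A →L[ℂ] ℂ) →L[ℂ] ℂ) (ψ : A →L[ℂ] ℂ), ψ (k m) = m (dArL A a ψ) := fun m ψ =>
    DFunLike.congr_fun (hk m) ψ
  have hcont : Continuous fun m : WeakDual ℂ (A →L[ℂ] ℂ) =>
      (toWeakSpace ℂ (A →L[ℂ] ℂ)) (dArL A (k (WeakDual.toStrongDual m)) φ) := by
    refine WeakBilin.continuous_of_continuous_eval _ fun n => ?_
    have : (fun m : WeakDual ℂ (A →L[ℂ] ℂ) => n (dArL A (k (WeakDual.toStrongDual m)) φ)) =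
        fun m => m (dArL A a (fBd A φ n)) := by
      funext m
      exact hk' m (fBd A φ n)
    exact this ▸ WeakDual.eval_continuous _
  refine ((WeakDual.isCompact_closedBall (0 : StrongDual ℂ (A →L[ℂ] ℂ)) 1).image
    hcont).closure_of_subset ?_
  rintro _ ⟨b, hb, rfl⟩
  refine ⟨StrongDual.toWeakDual (ιA A b), ?_, ?_⟩
  · simp only [Set.mem_preimage, mem_closedBall_zero_iff] at hb ⊢
    refine opNorm_le_bound _ zero_le_one fun ψ => ?_
    calc ‖ψ b‖ ≤ ‖ψ‖ * 1 := ψ.le_opNorm_of_le hb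
      _ = 1 * ‖ψ‖ := mul_comm _ _
  · refine ContinuousLinearMap.ext fun c : A => ?_
    refine (hk' (ιA A b) (dArR A φ c)).trans ?_
    change φ (c * (b * a)) = φ (c * b * a)
    rw [mul_assoc]

theorem dArR_mem_WAPset (hIdeal : IdealInBidual A) (a : A) (φ : A →L[ℂ] ℂ) :
    dArR A φ a ∈ WAPset A := by
  choose k hk using fun m => (hIdeal m a).2
  have hk' : ∀ (m : (A →L[ℂ] ℂ) →L[ℂ] ℂ) (ψ : A →L[ℂ] ℂ), ψ (k m) = m (dArR A ψ a) := fun m ψ =>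
    DFunLike.congr_fun (hk m) ψ
  have hcont : Continuous fun ψ : WeakDual ℂ A =>
      (toWeakSpace ℂ (A →L[ℂ] ℂ)) (dArR A (WeakDual.toStrongDual ψ) a) := by
    refine WeakBilin.continuous_of_continuous_eval _ fun n => ?_
    have : (fun ψ : WeakDual ℂ A => n (dArR A (WeakDual.toStrongDual ψ) a)) =
        fun ψ => ψ (k n) := by
      funext ψ
      exact (hk' n (WeakDual.toStrongDual ψ)).symm
    exact this ▸ WeakDual.eval_continuous _
  refine ((WeakDual.isCompact_closedBall (0 : StrongDual ℂ A) ‖φ‖).image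
    hcont).closure_of_subset ?_
  rintro _ ⟨b, hb, rfl⟩
  refine ⟨StrongDual.toWeakDual (dArL A b φ), ?_, ?_⟩
  · simp only [Set.mem_preimage, mem_closedBall_zero_iff] at hb ⊢
    refine opNorm_le_bound _ (norm_nonneg φ) fun c => ?_
    calc ‖φ (c * b)‖ ≤ ‖φ‖ * (‖c‖ * ‖b‖) := φ.le_opNorm_of_le (norm_mul_le c b)
      _ ≤ ‖φ‖ * (‖c‖ * 1) := by gcongr
      _ = ‖φ‖ * ‖c‖ := by rw [mul_one]
  · refine ContinuousLinearMap.ext fun c : A => ?_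
    change φ (a * c * b) = φ (a * (c * b))
    rw [mul_assoc]

theorem ar1_assoc (m n p : (A →L[ℂ] ℂ) →L[ℂ] ℂ) :
    ar1 A (ar1 A m n) p = ar1 A m (ar1 A n p) := by
  refine ContinuousLinearMap.ext fun φ => congrArg m (ContinuousLinearMap.ext fun a => ?_)
  refine congrArg n (ContinuousLinearMap.ext fun b => congrArg p ?_)
  refine ContinuousLinearMap.ext fun c => congrArg φ ?_
  exact mul_assoc a b c

theorem ar2_assoc (m n p : (A →L[ℂ] ℂ) →L[ℂ] ℂ) :
    ar2 A (ar2 A m n) p = ar2 A m (ar2 A n p) := by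
  refine ContinuousLinearMap.ext fun φ => congrArg p (ContinuousLinearMap.ext fun a => ?_)
  refine congrArg n (ContinuousLinearMap.ext fun b => congrArg m ?_)
  refine ContinuousLinearMap.ext fun c => congrArg φ ?_
  exact mul_assoc c b a

variable {J : Submodule ℂ A}

theorem ar1_mem_bidualOf_of_right (hJ : IsClosedIdeal A J) (m : (A →L[ℂ] ℂ) →L[ℂ] ℂ)
    {s : (A →L[ℂ] ℂ) →L[ℂ] ℂ} (hs : s ∈ bidualOf A J) : ar1 A m s ∈ bidualOf A J := by
  intro φ hφ
  have h : bdF A s φ = 0 := ContinuousLinearMap.ext fun a =>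
    hs (dArR A φ a) fun b hb => hφ _ (hJ.2.1 a b hb)
  exact (congrArg m h).trans (map_zero m)

theorem ar1_mem_bidualOf_of_left (hJ : IsClosedIdeal A J) {s : (A →L[ℂ] ℂ) →L[ℂ] ℂ}
    (hs : s ∈ bidualOf A J) (m : (A →L[ℂ] ℂ) →L[ℂ] ℂ) : ar1 A s m ∈ bidualOf A J := by
  intro φ hφ
  refine hs (bdF A m φ) fun a ha => ?_
  have h : dArR A φ a = 0 := ContinuousLinearMap.ext fun b => hφ _ (hJ.2.2 b a ha)
  exact (congrArg m h).trans (map_zero m)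

theorem ar2_mem_bidualOf_of_left (hJ : IsClosedIdeal A J) {s : (A →L[ℂ] ℂ) →L[ℂ] ℂ}
    (hs : s ∈ bidualOf A J) (m : (A →L[ℂ] ℂ) →L[ℂ] ℂ) : ar2 A s m ∈ bidualOf A J := by
  intro φ hφ
  have h : fBd A φ s = 0 := ContinuousLinearMap.ext fun a =>
    hs (dArL A a φ) fun b hb => hφ _ (hJ.2.2 a b hb)
  exact (congrArg m h).trans (map_zero m)

theorem ar2_mem_bidualOf_of_right (hJ : IsClosedIdeal A J) (m : (A →L[ℂ] ℂ) →L[ℂ] ℂ)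
    {s : (A →L[ℂ] ℂ) →L[ℂ] ℂ} (hs : s ∈ bidualOf A J) : ar2 A m s ∈ bidualOf A J := by
  intro φ hφ
  refine hs (fBd A φ m) fun a ha => ?_
  have h : dArL A a φ = 0 := ContinuousLinearMap.ext fun b => hφ _ (hJ.2.1 b a ha)
  exact (congrArg m h).trans (map_zero m)

theorem sub_mem_bidualOf {A : Type*} [NonUnitalNormedRing A] [NormedSpace ℂ A]
    {J : Submodule ℂ A} {s t : (A →L[ℂ] ℂ) →L[ℂ] ℂ} (hs : s ∈ bidualOf A J)
    (ht : t ∈ bidualOf A J) : s - t ∈ bidualOf A J := fun φ hφ => by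
  rw [sub_apply, hs φ hφ, ht φ hφ, sub_zero]

theorem ar1_eq_zero_of_mem_wapPerp (hIdeal : IdealInBidual A) (m : (A →L[ℂ] ℂ) →L[ℂ] ℂ)
    {r : (A →L[ℂ] ℂ) →L[ℂ] ℂ} (hr : r ∈ wapPerp A J) : ar1 A m r = 0 := by
  refine ContinuousLinearMap.ext fun φ => ?_
  have h : bdF A r φ = 0 := ContinuousLinearMap.ext fun a =>
    hr.2 _ (dArR_mem_WAPset hIdeal a φ)
  exact (congrArg m h).trans (map_zero m)

theorem ar2_eq_zero_of_mem_wapPerp (hIdeal : IdealInBidual A) {r : (A →L[ℂ] ℂ) →L[ℂ] ℂ}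
    (hr : r ∈ wapPerp A J) (m : (A →L[ℂ] ℂ) →L[ℂ] ℂ) : ar2 A r m = 0 := by
  refine ContinuousLinearMap.ext fun φ => ?_
  have h : fBd A φ r = 0 := ContinuousLinearMap.ext fun a =>
    hr.2 _ (dArL_mem_WAPset hIdeal a φ)
  exact (congrArg m h).trans (map_zero m)

theorem isClosed_wapPerp (J : Submodule ℂ A) : IsClosed (wapPerp A J) := by
  have h : wapPerp A J = (⋂ φ : A →L[ℂ] ℂ, ⋂ _ : ∀ a ∈ J, φ a = 0,
      {s : (A →L[ℂ] ℂ) →L[ℂ] ℂ | s φ = 0}) ∩ ⋂ φ ∈ WAPset A, {s | s φ = 0} := by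
    ext r
    simp [wapPerp, bidualOf]
  have hker : ∀ φ : A →L[ℂ] ℂ, IsClosed {s : (A →L[ℂ] ℂ) →L[ℂ] ℂ | s φ = 0} := fun φ =>
    isClosed_eq (ContinuousLinearMap.apply ℂ ℂ φ).continuous continuous_const
  rw [h]
  exact (isClosed_iInter fun φ => isClosed_iInter fun _ => hker φ).inter
    (isClosed_biInter fun φ _ => hker φ)

end ArensLemmas

/-- Let `A` be a Banach algebra that is a two-sided ideal in its bidual
(first Arens product) and has a bounded approximate identity with associated mixed identity
`e ∈ A**`.  Let `J` be a closed ideal of `A`.  Working inside `A**` (where `J**` is canonically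
realized as `bidualOf A J = J^{⊥⊥}` and `i*(WAP(A))^⊥` as `wapPerp A J`), the identities
`m = em + (m - em)` and `m = m◊e + (m - m◊e)` give internal direct sum decompositions
`J** = eJ** ⊕ i*(WAP(A))^⊥` and `J** = J**◊e ⊕ i*(WAP(A))^⊥`; moreover
`J** · i*(WAP(A))^⊥ = {0}`, `i*(WAP(A))^⊥ ◊ J** = {0}`, and `i*(WAP(A))^⊥` is a closed
two-sided ideal of `J**` for both Arens products. -/
theorem statement0 (A : Type*) [NonUnitalNormedRing A] [NormedSpace ℂ A]
    [IsScalarTower ℂ A A] [SMulCommClass ℂ A A] [CompleteSpace A]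
    (hIdeal : IdealInBidual A) (hBAI : HasBAI A)
    (e : (A →L[ℂ] ℂ) →L[ℂ] ℂ) (he : IsMixedIdentity A e)
    (J : Submodule ℂ A) (hJ : IsClosedIdeal A J) :
    -- the decomposition `m = em + (m - em)` stays inside `J**`, with `m - em ∈ i*(WAP(A))^⊥`
    (∀ s ∈ bidualOf A J, ar1 A e s ∈ bidualOf A J ∧ s - ar1 A e s ∈ wapPerp A J) ∧
    -- the decomposition `m = m◊e + (m - m◊e)` likewise
    (∀ s ∈ bidualOf A J, ar2 A s e ∈ bidualOf A J ∧ s - ar2 A s e ∈ wapPerp A J) ∧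
    -- the sums are direct: `eJ** ∩ i*(WAP(A))^⊥ = {0}` and `(J**◊e) ∩ i*(WAP(A))^⊥ = {0}`
    (∀ t, (∃ s ∈ bidualOf A J, t = ar1 A e s) → t ∈ wapPerp A J → t = 0) ∧
    (∀ t, (∃ s ∈ bidualOf A J, t = ar2 A s e) → t ∈ wapPerp A J → t = 0) ∧
    -- `J** · i*(WAP(A))^⊥ = {0}` and `i*(WAP(A))^⊥ ◊ J** = {0}`
    (∀ s ∈ bidualOf A J, ∀ r ∈ wapPerp A J, ar1 A s r = 0 ∧ ar2 A r s = 0) ∧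
    -- `i*(WAP(A))^⊥` is a closed two-sided ideal of `J**` for both Arens products
    IsClosed (wapPerp A J) ∧
    (∀ r ∈ wapPerp A J, ∀ s ∈ bidualOf A J,
      ar1 A s r ∈ wapPerp A J ∧ ar1 A r s ∈ wapPerp A J ∧
      ar2 A s r ∈ wapPerp A J ∧ ar2 A r s ∈ wapPerp A J) := by
  have hreg := fun {φ : A →L[ℂ] ℂ} (hφ : φ ∈ WAPset A) =>
    ar1_apply_eq_ar2_apply_of_mem_WAPset hφ
  have hzero : (0 : (A →L[ℂ] ℂ) →L[ℂ] ℂ) ∈ wapPerp A J := ⟨fun _ _ => rfl, fun _ _ => rfl⟩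
  refine ⟨fun s hs => ?_, fun s hs => ?_, ?_, ?_, fun s _ r hr =>
    ⟨ar1_eq_zero_of_mem_wapPerp hIdeal s hr, ar2_eq_zero_of_mem_wapPerp hIdeal hr s⟩,
    isClosed_wapPerp J, fun r hr s hs => ⟨?_, ?_, ?_, ?_⟩⟩
  · have hes := ar1_mem_bidualOf_of_right hJ e hs
    refine ⟨hes, sub_mem_bidualOf hs hes, fun φ hφ => ?_⟩
    rw [sub_apply, hreg hφ, he.2, sub_self]
  · have hse := ar2_mem_bidualOf_of_left hJ hs e
    refine ⟨hse, sub_mem_bidualOf hs hse, fun φ hφ => ?_⟩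
    rw [sub_apply, ← hreg hφ, he.1, sub_self]
  · rintro _ ⟨s, -, rfl⟩ ht
    rw [← ar1_eq_zero_of_mem_wapPerp hIdeal e ht, ← ar1_assoc, he.1]
  · rintro _ ⟨s, -, rfl⟩ ht
    rw [← ar2_eq_zero_of_mem_wapPerp hIdeal ht e, ar2_assoc, he.2]
  · rwa [ar1_eq_zero_of_mem_wapPerp hIdeal s hr]
  · refine ⟨ar1_mem_bidualOf_of_left hJ hr.1 s, fun φ hφ => ?_⟩
    rw [hreg hφ, ar2_eq_zero_of_mem_wapPerp hIdeal hr s, zero_apply]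
  · refine ⟨ar2_mem_bidualOf_of_right hJ s hr.1, fun φ hφ => ?_⟩
    rw [← hreg hφ, ar1_eq_zero_of_mem_wapPerp hIdeal s hr, zero_apply]
  · rwa [ar2_eq_zero_of_mem_wapPerp hIdeal hr s]
end
end

section
/- Let A be a Banach algebra in the wsaBAI class. If m ∈ A** satisfies A*·m ⊆ WAP(A) or m·A* ⊆ WAP(A), then m = a₀ + r for some a₀ ∈ A and some r ∈ WAP(A)^⊥ = {r ∈ A** : ⟨r, φ⟩ = 0 for all φ ∈ WAP(A)}. -/
noncomputable section

open Filter Topology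

/-- If bounded operators `L i` converge to `G` at every `x k`, they converge to `G` at every weak
limit of the `x k`. -/
theorem tendsto_apply_of_weak_limit {X Y ι κ : Type*} [NormedAddCommGroup X] [NormedSpace ℂ X]
    [NormedAddCommGroup Y] [NormedSpace ℂ Y] {l : Filter ι} {L : ι → X →L[ℂ] Y} {G : X →L[ℂ] Y}
    {C : ℝ} (hC : ∀ i, ‖L i‖ ≤ C) {l' : Filter κ} [l'.NeBot] {x : κ → X} {x₀ : X}
    (hx : ∀ k, Tendsto (fun i => L i (x k)) l (𝓝 (G (x k))))
    (hweak : ∀ f : X →L[ℂ] ℂ, Tendsto (fun k => f (x k)) l' (𝓝 (f x₀))) :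
    Tendsto (fun i => L i x₀) l (𝓝 (G x₀)) := by
  let S : Submodule ℂ X :=
    { carrier := {y | Tendsto (fun i => L i y) l (𝓝 (G y))}
      add_mem' := fun {a b} ha hb => by
        simpa only [Set.mem_ofPred_eq, map_add] using Tendsto.add ha hb
      zero_mem' := by simpa using tendsto_const_nhds
      smul_mem' := fun c a ha => by
        simpa only [Set.mem_ofPred_eq, map_smul] using Tendsto.const_smul ha c }
  have hS : ∀ y, y ∈ S ↔ Tendsto (fun i => L i y) l (𝓝 (G y)) := fun _ => Iff.rfl
  have hmem : x₀ ∈ closure (S : Set X) := by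
    by_contra hx₀
    obtain ⟨f, u, hfu, hu⟩ := RCLike.geometric_hahn_banach_closed_point (𝕜 := ℂ)
      ((S.restrictScalars ℝ).convex.closure) isClosed_closure hx₀
    have hre : Tendsto (fun k => RCLike.re (f (x k))) l' (𝓝 (RCLike.re (f x₀))) :=
      (RCLike.continuous_re.tendsto _).comp (hweak f)
    exact absurd (le_of_tendsto hre (Eventually.of_forall fun k =>
      (hfu _ (subset_closure ((hS _).2 (hx k)))).le)) (not_le.2 hu)
  rw [Metric.tendsto_nhds]
  intro ε hε
  have hK : 0 < |C| + ‖G‖ + 1 := by positivity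
  obtain ⟨y, hyS, hy⟩ := Metric.mem_closure_iff.1 hmem (ε / 2 / (|C| + ‖G‖ + 1)) (by positivity)
  have hy' : ‖x₀ - y‖ * (|C| + ‖G‖ + 1) < ε / 2 := by
    rwa [dist_eq_norm, lt_div_iff₀ hK] at hy
  filter_upwards [Metric.tendsto_nhds.1 ((hS y).1 hyS) (ε / 2) (by positivity)] with i hi
  have h₁ : ‖L i (x₀ - y)‖ ≤ |C| * ‖x₀ - y‖ :=
    (L i).le_of_opNorm_le ((hC i).trans (le_abs_self C)) _
  have h₂ : ‖G (x₀ - y)‖ ≤ ‖G‖ * ‖x₀ - y‖ := G.le_opNorm _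
  rw [dist_eq_norm] at hi ⊢
  have h₃ : L i x₀ - G x₀ = L i (x₀ - y) + (L i y - G y) - G (x₀ - y) := by
    simp only [map_sub]; abel
  rw [h₃]
  have h₄ := norm_sub_le (L i (x₀ - y) + (L i y - G y)) (G (x₀ - y))
  have h₅ := norm_add_le (L i (x₀ - y)) (L i y - G y)
  nlinarith [norm_nonneg (x₀ - y)]

/-- A bounded family in a normed space converges weak-* in the bidual along any ultrafilter. -/
theorem exists_bidual_limit {X ι : Type*} [NormedAddCommGroup X] [NormedSpace ℂ X] {u : ι → X}
    {C : ℝ} (hu : ∀ i, ‖u i‖ ≤ C) (U : Ultrafilter ι) :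
    ∃ E : (X →L[ℂ] ℂ) →L[ℂ] ℂ, ∀ f : X →L[ℂ] ℂ, Tendsto (fun i => f (u i)) U (𝓝 (E f)) := by
  let v : ι → WeakDual ℂ (X →L[ℂ] ℂ) := fun i =>
    StrongDual.toWeakDual (NormedSpace.inclusionInDoubleDual ℂ X (u i))
  have hcomp := WeakDual.isCompact_closedBall (𝕜 := ℂ) (E := X →L[ℂ] ℂ) 0 C
  obtain ⟨E, -, hE⟩ := hcomp.ultrafilter_le_nhds' (U.map v) <| by
    refine Filter.mem_map.2 (Filter.univ_mem' fun i => ?_)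
    simpa [v] using (NormedSpace.double_dual_bound ℂ X (u i)).trans (hu i)
  exact ⟨WeakDual.toStrongDual E, fun f =>
    ((WeakDual.eval_continuous f).tendsto E).comp (tendsto_iff_comap.2 (map_le_iff_le_comap.1 hE))⟩

set_option maxSynthPendingDepth 3 in
/-- A continuous linear map into the bidual with values in the canonical image of the space
factors through the space. -/
theorem exists_lift_of_range {𝕜 X Z : Type*} [RCLike 𝕜] [NormedAddCommGroup X]
    [NormedSpace 𝕜 X] [NormedAddCommGroup Z] [NormedSpace 𝕜 Z]
    (S : Z →L[𝕜] (X →L[𝕜] 𝕜) →L[𝕜] 𝕜)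
    (hS : ∀ z, ∃ x : X, ∀ f : X →L[𝕜] 𝕜, f x = S z f) :
    ∃ T : Z →L[𝕜] X, ∀ z (f : X →L[𝕜] 𝕜), f (T z) = S z f := by
  choose T hT using hS
  have hext : ∀ x y : X, (∀ f : X →L[𝕜] 𝕜, f x = f y) → x = y := fun x y =>
    (SeparatingDual.eq_iff_forall_dual_eq (R := 𝕜)).2
  refine ⟨LinearMap.mkContinuous
    { toFun := T
      map_add' := fun y z => hext _ _ fun f => by simp [hT]
      map_smul' := fun c z => hext _ _ fun f => by simp [hT] } ‖S‖ fun z => ?_, hT⟩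
  refine NormedSpace.norm_le_dual_bound 𝕜 (T z) (by positivity) fun f => ?_
  rw [hT]
  exact S.le_opNorm₂ z f

section WeaklyAlmostPeriodic

variable {A : Type*} [NonUnitalNormedRing A] [NormedSpace ℂ A]
  [IsScalarTower ℂ A A] [SMulCommClass ℂ A A]

/-- For weakly almost periodic `φ` and bounded `u`, the `u i · φ` converge weakly along any
ultrafilter. -/
theorem exists_weak_limit_of_mem_WAPset {ι : Type*} {φ : A →L[ℂ] ℂ} (hφ : φ ∈ WAPset A)
    {u : ι → A} {C : ℝ} (hu : ∀ i, ‖u i‖ ≤ C) (U : Ultrafilter ι) :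
    ∃ ψ : A →L[ℂ] ℂ, ∀ m : (A →L[ℂ] ℂ) →L[ℂ] ℂ,
      Tendsto (fun i => m (dArL A (u i) φ)) U (𝓝 (m ψ)) := by
  set c : ℂ := ((|C| + 1 : ℝ) : ℂ) with hc
  have hc0 : c ≠ 0 := Complex.ofReal_ne_zero.2 (by positivity)
  have hcn : ‖c‖ = |C| + 1 := by rw [hc, Complex.norm_real, Real.norm_of_nonneg (by positivity)]
  let v : ι → WeakSpace ℂ (A →L[ℂ] ℂ) := fun i =>
    toWeakSpace ℂ (A →L[ℂ] ℂ) (dArL A (c⁻¹ • u i) φ)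
  obtain ⟨ψ, -, hψ⟩ := IsCompact.ultrafilter_le_nhds' hφ (U.map v) <| by
    refine Filter.mem_map.2 (Filter.univ_mem' fun i => subset_closure ⟨c⁻¹ • u i, ?_, rfl⟩)
    rw [mem_closedBall_zero_iff, norm_smul, norm_inv, hcn, inv_mul_le_iff₀ (by positivity)]
    linarith [hu i, le_abs_self C]
  refine ⟨c • (toWeakSpace ℂ (A →L[ℂ] ℂ)).symm ψ, fun m => ?_⟩
  have hm : Continuous fun ξ : WeakSpace ℂ (A →L[ℂ] ℂ) =>
      m ((toWeakSpace ℂ (A →L[ℂ] ℂ)).symm ξ) :=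
    WeakBilin.eval_continuous (topDualPairing ℂ (A →L[ℂ] ℂ)).flip m
  have ht := ((hm.tendsto ψ).comp (tendsto_iff_comap.2 (map_le_iff_le_comap.1 hψ))).const_mul c
  rw [map_smul, smul_eq_mul]
  refine ht.congr fun i => ?_
  have h : dArL A (u i) φ = c • dArL A (c⁻¹ • u i) φ := by
    ext b
    simp [dArL, hc0]
  simp [v, h]

/-- Along a bounded right approximate identity, `u i · φ` tends weakly to a weakly almost
periodic `φ`. -/
theorem tendsto_weak_dArL {ι : Type*} {l : Filter ι} {φ : A →L[ℂ] ℂ} (hφ : φ ∈ WAPset A)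
    {u : ι → A} {C : ℝ} (hu : ∀ i, ‖u i‖ ≤ C) (hr : ∀ a : A, Tendsto (fun i => a * u i) l (𝓝 a))
    (m : (A →L[ℂ] ℂ) →L[ℂ] ℂ) : Tendsto (fun i => m (dArL A (u i) φ)) l (𝓝 (m φ)) := by
  rw [tendsto_iff_ultrafilter]
  intro U hU
  obtain ⟨ψ, hψ⟩ := exists_weak_limit_of_mem_WAPset hφ hu U
  have : ψ = φ := by
    ext a
    exact tendsto_nhds_unique (hψ (ContinuousLinearMap.apply ℂ ℂ a))
      (((φ.continuous.tendsto a).comp (hr a)).mono_left hU)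
  exact this ▸ hψ m

/-- A weakly almost periodic functional converges along any bounded sequence that is an
approximate identity for its own terms. -/
theorem exists_tendsto_of_mem_WAPset {χ : A →L[ℂ] ℂ} (hχ : χ ∈ WAPset A) {e : ℕ → A} {C : ℝ}
    (he : ∀ n, ‖e n‖ ≤ C) (hr : ∀ k, Tendsto (fun n => e k * e n) atTop (𝓝 (e k)))
    (hl : ∀ k, Tendsto (fun n => e n * e k) atTop (𝓝 (e k))) :
    ∃ z, Tendsto (fun n => χ (e n)) atTop (𝓝 z) := by
  let V : Ultrafilter ℕ := Ultrafilter.of atTop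
  have hV : (V : Filter ℕ) ≤ atTop := Ultrafilter.of_le _
  obtain ⟨ψ, hψ⟩ := exists_weak_limit_of_mem_WAPset hχ he V
  have hψe : ∀ k, ψ (e k) = χ (e k) := fun k =>
    tendsto_nhds_unique (hψ (ContinuousLinearMap.apply ℂ ℂ (e k)))
      (((χ.continuous.tendsto _).comp (hr k)).mono_left hV)
  obtain ⟨F, hF⟩ := exists_bidual_limit he V
  refine ⟨F χ, tendsto_iff_ultrafilter _ _ _ |>.2 fun U hU => ?_⟩
  obtain ⟨E, hE⟩ := exists_bidual_limit he U
  have hE₁ : ∀ n, E (dArL A (e n) χ) = χ (e n) := fun n =>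
    tendsto_nhds_unique (hE _) (((χ.continuous.tendsto _).comp (hl n)).mono_left hU)
  have hE₂ : E ψ = E χ :=
    tendsto_nhds_unique (hE ψ) ((hE χ).congr fun k => (hψe k).symm)
  have hE₃ : E ψ = F χ := tendsto_nhds_unique (hψ E) ((hF χ).congr fun n => (hE₁ n).symm)
  rw [← hE₃, hE₂]
  exact hE χ

end WeaklyAlmostPeriodic

/-- If the image of a filter is not Cauchy, then there is a sequence of indices whose images
are not Cauchy and which satisfies prescribed eventual relations at a prescribed rate. -/
theorem exists_seq_of_not_cauchy {X ι : Type*} [PseudoMetricSpace X] {l : Filter ι} [l.NeBot]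
    {f : ι → X} (hf : ¬ Cauchy (map f l)) (P : ℕ → ι → ι → Prop)
    (hP : ∀ n i, ∀ᶠ j in l, P n i j) :
    ∃ s : ℕ → ι, ¬ CauchySeq (f ∘ s) ∧ ∀ k n, k ≤ n → P n (s k) (s (n + 1)) := by
  classical
  obtain ⟨ε, hε, hl⟩ : ∃ ε > 0, ∀ t ∈ l, ∃ i ∈ t, ∃ j ∈ t, ε ≤ dist (f i) (f j) := by
    by_contra! hcon
    refine hf (Metric.cauchy_iff.2 ⟨inferInstance, fun ε hε => ?_⟩)
    obtain ⟨t, ht, h⟩ := hcon ε hε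
    refine ⟨f '' t, image_mem_map ht, ?_⟩
    rintro _ ⟨i, hi, rfl⟩ _ ⟨j, hj, rfl⟩
    exact h i hi j hj
  have hstep : ∀ (n : ℕ) (σ : Finset ι × ι), ∃ j, (∀ i ∈ σ.1, P n i j) ∧
      ε / 2 ≤ dist (f σ.2) (f j) := by
    intro n σ
    obtain ⟨i, hi, j, hj, hij⟩ := hl _ ((Finset.eventually_all σ.1).2 fun i _ => hP n i)
    by_contra! hcon
    have h₁ := hcon i hi
    have h₂ := hcon j hj
    linarith [dist_triangle_left (f i) (f j) (f σ.2)]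
  choose g hgP hgd using hstep
  obtain ⟨i₀⟩ : Nonempty ι := l.nonempty_of_neBot
  let st : ℕ → Finset ι × ι := fun n =>
    Nat.rec ({i₀}, i₀) (fun n σ => (insert (g n σ) σ.1, g n σ)) n
  have hst : ∀ n, st (n + 1) = (insert (g n (st n)) (st n).1, g n (st n)) := fun _ => rfl
  have hmono : Monotone fun n => (st n).1 :=
    monotone_nat_of_le_succ fun n => by simp only [hst]; exact Finset.subset_insert _ _
  have hmem : ∀ n, (st n).2 ∈ (st n).1 := fun n => by
    cases n with
    | zero => exact Finset.mem_singleton_self _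
    | succ n => simp [hst]
  refine ⟨fun n => (st n).2, fun hc => ?_, fun k n hkn => ?_⟩
  · obtain ⟨N, hN⟩ := Metric.cauchySeq_iff.1 hc (ε / 2) (by positivity)
    exact absurd (hgd N (st N)) (not_le.2 (hN N le_rfl (N + 1) (Nat.le_succ N)))
  · exact hgP n (st n) _ (hmono hkn (hmem k))

/-- Let `p` be an associative multiplication on a weakly sequentially complete space and `T` a
left multiplier. If `T` maps all bounded sequences that are approximate identities for their own
terms to weakly Cauchy sequences, it maps every bounded approximate identity to a norm convergent
net. -/
theorem exists_tendsto_multiplier {A ι : Type*} [NonUnitalNormedRing A] [NormedSpace ℂ A]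
    [CompleteSpace A] (hA : WeaklySequentiallyComplete A) (p : A →L[ℂ] A →L[ℂ] A) (T : A →L[ℂ] A)
    (hT : ∀ a b, T (p a b) = p a (T b)) {l : Filter ι} [l.NeBot] {u : ι → A} {C : ℝ}
    (hu : ∀ i, ‖u i‖ ≤ C) (hr : ∀ a, Tendsto (fun i => p a (u i)) l (𝓝 a))
    (hl : ∀ a, Tendsto (fun i => p (u i) a) l (𝓝 a))
    (hweak : ∀ e : ℕ → A, (∀ n, ‖e n‖ ≤ C) →
      (∀ k, Tendsto (fun n => p (e k) (e n)) atTop (𝓝 (e k))) →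
      (∀ k, Tendsto (fun n => p (e n) (e k)) atTop (𝓝 (e k))) →
      ∀ f : A →L[ℂ] ℂ, ∃ z, Tendsto (fun n => f (T (e n))) atTop (𝓝 z)) :
    ∃ a, Tendsto (fun i => T (u i)) l (𝓝 a) := by
  refine CompleteSpace.complete (f := map (fun i => T (u i)) l) ?_
  by_contra hnc
  obtain ⟨s, hs, hsP⟩ := exists_seq_of_not_cauchy hnc
    (fun n i j => dist (p (u i) (u j)) (u i) < 1 / ((n : ℝ) + 1) ∧
      dist (p (u j) (u i)) (u i) < 1 / ((n : ℝ) + 1))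
    (fun n i => (Metric.tendsto_nhds.1 (hr (u i)) _ Nat.one_div_pos_of_nat).and
      (Metric.tendsto_nhds.1 (hl (u i)) _ Nat.one_div_pos_of_nat))
  let e : ℕ → A := fun n => u (s n)
  have he : ∀ n, ‖e n‖ ≤ C := fun n => hu _
  have her : ∀ k, Tendsto (fun n => p (e k) (e n)) atTop (𝓝 (e k)) := fun k => by
    rw [← tendsto_add_atTop_iff_nat 1, tendsto_iff_dist_tendsto_zero]
    refine squeeze_zero' (Eventually.of_forall fun _ => dist_nonneg) ?_
      tendsto_one_div_add_atTop_nhds_zero_nat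
    filter_upwards [eventually_ge_atTop k] with n hn using (hsP k n hn).1.le
  have hel : ∀ k, Tendsto (fun n => p (e n) (e k)) atTop (𝓝 (e k)) := fun k => by
    rw [← tendsto_add_atTop_iff_nat 1, tendsto_iff_dist_tendsto_zero]
    refine squeeze_zero' (Eventually.of_forall fun _ => dist_nonneg) ?_
      tendsto_one_div_add_atTop_nhds_zero_nat
    filter_upwards [eventually_ge_atTop k] with n hn using (hsP k n hn).2.le
  obtain ⟨a, ha⟩ := hA (fun n => T (e n)) (hweak e he her hel)
  have hea : ∀ k, p (e k) a = T (e k) := fun k => by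
    refine (SeparatingDual.eq_iff_forall_dual_eq (R := ℂ)).2 fun f => ?_
    refine tendsto_nhds_unique (ha (f.comp (p (e k)))) ?_
    simp only [ContinuousLinearMap.comp_apply, ← hT]
    exact ((f.comp T).continuous.tendsto _).comp (her k)
  have hlim : Tendsto (fun n => p (e n) a) atTop (𝓝 a) :=
    tendsto_apply_of_weak_limit (L := fun n => p (e n)) (G := ContinuousLinearMap.id ℂ A)
      (C := ‖p‖ * C)
      (fun n => (p.le_opNorm _).trans (mul_le_mul_of_nonneg_left (he n) (norm_nonneg p)))
      (fun k => by
        simp only [← hT]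
        exact (T.continuous.tendsto _).comp (hel k)) ha
  exact hs (hlim.congr hea).cauchySeq

/-- Let `A` be a Banach algebra in the wsaBAI class.  If `m ∈ A**`
satisfies `A* · m ⊆ WAP(A)` or `m · A* ⊆ WAP(A)`, then `m = a₀ + r` for some `a₀ ∈ A` and
some `r ∈ WAP(A)^⊥ = {r ∈ A** : ⟨r, φ⟩ = 0 for all φ ∈ WAP(A)}`. -/
theorem statement2 (A : Type*) [NonUnitalNormedRing A] [NormedSpace ℂ A]
    [IsScalarTower ℂ A A] [SMulCommClass ℂ A A] [CompleteSpace A]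
    (h : IsWSABAI A) (m : (A →L[ℂ] ℂ) →L[ℂ] ℂ)
    (hm : (∀ φ : A →L[ℂ] ℂ, fBd A φ m ∈ WAPset A) ∨
          (∀ φ : A →L[ℂ] ℂ, bdF A m φ ∈ WAPset A)) :
    ∃ a₀ : A, ∃ r : (A →L[ℂ] ℂ) →L[ℂ] ℂ,
      (∀ φ ∈ WAPset A, r φ = 0) ∧ m = ιA A a₀ + r := by
  obtain ⟨hwsc, ⟨ι, l, u, hl, hb, hr, hle⟩, hid⟩ := h
  obtain ⟨C, hC⟩ := hb.exists_norm_le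
  have hu : ∀ i, ‖u i‖ ≤ C := fun i => hC _ ⟨i, rfl⟩
  suffices hsuff : ∃ a₀ : A, ∀ φ ∈ WAPset A, m φ = φ a₀ by
    obtain ⟨a₀, ha₀⟩ := hsuff
    exact ⟨a₀, m - ιA A a₀, fun φ hφ => sub_eq_zero.2 (ha₀ φ hφ), by abel⟩
  obtain ⟨R, hR⟩ := exists_lift_of_range
    ((ContinuousLinearMap.compL ℂ (A →L[ℂ] ℂ) (A →L[ℂ] ℂ) ℂ m).comp (dArLL A).flip)
    fun a => by
      obtain ⟨x, hx⟩ := (hid m a).1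
      exact ⟨x, DFunLike.congr_fun hx⟩
  replace hR : ∀ a φ, φ (R a) = m (dArL A a φ) := hR
  rcases hm with hm | hm
  · obtain ⟨a₀, ha₀⟩ := exists_tendsto_multiplier hwsc (ContinuousLinearMap.mul ℂ A).flip R
      (fun a b => by
        refine (SeparatingDual.eq_iff_forall_dual_eq (R := ℂ)).2 fun f => ?_
        refine (hR _ f).trans (Eq.trans (congrArg m ?_) (hR b (dArL A a f)).symm)
        ext c
        simp [dArL, mul_assoc]) hu hle hr
      (fun e he her hel f => by
        obtain ⟨z, hz⟩ := exists_tendsto_of_mem_WAPset (hm f) he hel her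
        exact ⟨z, hz.congr fun n => (hR (e n) f).symm⟩)
    refine ⟨a₀, fun φ hφ => tendsto_nhds_unique (tendsto_weak_dArL hφ hu hr m) ?_⟩
    exact ((φ.continuous.tendsto _).comp ha₀).congr fun i => hR (u i) φ
  · obtain ⟨T, hT⟩ := exists_lift_of_range
      ((ContinuousLinearMap.compL ℂ (A →L[ℂ] ℂ) (A →L[ℂ] ℂ) ℂ m).comp (dArRL A).flip)
      fun a => by
        obtain ⟨x, hx⟩ := (hid m a).2
        exact ⟨x, DFunLike.congr_fun hx⟩
    replace hT : ∀ a φ, φ (T a) = m (dArR A φ a) := hT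
    obtain ⟨a₀, ha₀⟩ := exists_tendsto_multiplier hwsc (ContinuousLinearMap.mul ℂ A) T
      (fun a b => by
        refine (SeparatingDual.eq_iff_forall_dual_eq (R := ℂ)).2 fun f => ?_
        refine (hT _ f).trans (Eq.trans (congrArg m ?_) (hT b (dArR A f a)).symm)
        ext c
        simp [dArR, mul_assoc]) hu hr hle
      (fun e he her hel f => by
        obtain ⟨z, hz⟩ := exists_tendsto_of_mem_WAPset (hm f) he her hel
        exact ⟨z, hz.congr fun n => (hT (e n) f).symm⟩)
    refine ⟨a₀, fun φ hφ => tendsto_nhds_unique (f := fun i => m (dArR A φ (u i))) (l := l) ?_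
      (((φ.continuous.tendsto _).comp ha₀).congr fun i => hT (u i) φ)⟩
    refine tendsto_apply_of_weak_limit (L := fun i => m.comp ((dArRL A).flip (u i))) (G := m)
      (C := ‖m‖ * (‖(dArRL A).flip‖ * C)) (fun i => ?_) (x := fun i => dArL A (u i) φ)
      (fun k => ?_) (tendsto_weak_dArL hφ hu hr)
    · refine (ContinuousLinearMap.opNorm_comp_le _ _).trans ?_
      gcongr
      exact ((dArRL A).flip.le_opNorm _).trans
        (mul_le_mul_of_nonneg_left (hu i) (norm_nonneg _))
    · rw [← hR]
      refine ((φ.continuous.tendsto _).comp (hle (R (u k)))).congr fun i => ?_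
      refine (hR (u k) (dArR A φ (u i))).trans (congrArg m ?_)
      ext c
      simp [dArL, dArR, dArRL, mul_assoc]
end
end

section
/- Let A be a Banach algebra that is a two-sided ideal in its bidual A**. Then for every m, n, p ∈ A** and every φ ∈ A*: (1) (p·φ)·m = p·(φ·m); (2) (m◊n)p = m◊(np), where juxtaposition denotes the first Arens product and ◊ the second. -/
noncomputable section

open Filter Topology

/-- Let `A` be a Banach algebra that is a two-sided ideal in its bidual.
Then for every `m, n, p ∈ A**` and every `φ ∈ A*`:
(1) `(p · φ) · m = p · (φ · m)`;
(2) `(m ◊ n) p = m ◊ (n p)`, where juxtaposition is the first Arens product and `◊` the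
second. -/
theorem statement4 (A : Type*) [NonUnitalNormedRing A] [NormedSpace ℂ A]
    [IsScalarTower ℂ A A] [SMulCommClass ℂ A A] [CompleteSpace A]
    (hIdeal : IdealInBidual A) :
    (∀ (m p : (A →L[ℂ] ℂ) →L[ℂ] ℂ) (φ : A →L[ℂ] ℂ),
      fBd A (bdF A p φ) m = bdF A p (fBd A φ m)) ∧
    (∀ m n p : (A →L[ℂ] ℂ) →L[ℂ] ℂ,
      ar1 A (ar2 A m n) p = ar2 A m (ar1 A n p)) := by
  have key : ∀ (m p : (A →L[ℂ] ℂ) →L[ℂ] ℂ) (φ : A →L[ℂ] ℂ),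
      fBd A (bdF A p φ) m = bdF A p (fBd A φ m) := by
    intro m p φ
    ext a
    -- Both sides at `a` equal `⟨m, c · φ⟩`, where `c ∈ A` represents `a p`.
    obtain ⟨c, hc⟩ := (hIdeal p a).2
    have hp : ∀ ψ : A →L[ℂ] ℂ, p (dArRL A ψ a) = ψ c := fun ψ =>
      (DFunLike.congr_fun hc ψ).symm
    have hL : dArLL A (bdF A p φ) a = dArLL A φ c := by
      ext b
      change p (dArRL A φ (b * a)) = φ (b * c)
      have hb : dArRL A φ (b * a) = dArRL A (dArRL A φ b) a := by
        ext x
        exact congrArg φ (mul_assoc b a x)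
      rw [hb, hp]
      rfl
    calc fBd A (bdF A p φ) m a = m (dArLL A φ c) := congrArg m hL
      _ = bdF A p (fBd A φ m) a := (hp (fBd A φ m)).symm
  refine ⟨key, fun m n p => ?_⟩
  ext φ
  exact congrArg n (key m p φ)
end
end

section
/- Let A be a Banach algebra that is a two-sided ideal in its bidual A** and has a bounded approximate identity, and let J be a closed ideal of A with restriction map i* : A* → J*. Then the following are equivalent: (i) J is Arens regular; (ii) i*(WAP(A))^⊥ ⊆ Z₁(J**) ∩ Z₂(J**); (iii) J is a weak Riesz ideal in A; (iv) i*(WAP(A))^⊥·J** = {0} (first Arens product) and J**◊i*(WAP(A))^⊥ = {0} (second Arens product). Here i*(WAP(A))^⊥ = {r ∈ J** : ⟨r, i*(φ)⟩ = 0 for all φ ∈ WAP(A)}. -/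
noncomputable section

open Filter Topology

section Separation

variable {E : Type*} [NormedAddCommGroup E] [NormedSpace ℂ E]

/-- A point on which every functional annihilating `P` vanishes lies in the closure of `P`. -/
theorem mem_closure_of_forall_annihilator (P : Submodule ℂ E) (x : E)
    (h : ∀ f : E →L[ℂ] ℂ, (∀ p ∈ P, f p = 0) → f x = 0) : x ∈ closure (P : Set E) := by
  by_contra hx
  have hclosed : IsClosed (P.topologicalClosure : Set E) := P.isClosed_topologicalClosure
  have hne : (P.topologicalClosure.mkQL x) ≠ 0 := by
    intro h0
    exact hx ((Submodule.Quotient.mk_eq_zero _).1 h0)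
  obtain ⟨g, hg⟩ := SeparatingDual.exists_ne_zero (R := ℂ) hne
  refine hg (h (g.comp P.topologicalClosure.mkQL) fun p hp => ?_)
  have : P.topologicalClosure.mkQL p = 0 :=
    (Submodule.Quotient.mk_eq_zero _).2 (P.le_topologicalClosure hp)
  simp [this]

/-- Pointwise convergence of a bounded family of functionals passes to every point that is
indistinguishable from small perturbations of points of convergence. -/
theorem tendsto_apply_of_approx {ι : Type*} {l : Filter ι} {T : ι → E →L[ℂ] ℂ}
    {T₀ : E →L[ℂ] ℂ} {C : ℝ} (hT : ∀ j, ‖T j‖ ≤ C) (f : E)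
    (h : ∀ ε > 0, ∃ w v : E, Tendsto (fun j => T j w) l (𝓝 (T₀ w)) ∧ ‖v‖ < ε ∧
      (∀ j, T j f = T j (w + v)) ∧ T₀ f = T₀ (w + v)) :
    Tendsto (fun j => T j f) l (𝓝 (T₀ f)) := by
  rw [Metric.tendsto_nhds]
  intro ε hε
  set D : ℝ := |C| + ‖T₀‖ + 1 with hD
  have hDpos : 0 < D := by positivity
  obtain ⟨w, v, hw, hv, hf, hf₀⟩ := h (ε / 2 / D) (by positivity)
  filter_upwards [Metric.tendsto_nhds.1 hw (ε / 2) (by positivity)] with j hj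
  have hvD : D * ‖v‖ < ε / 2 := by
    rw [lt_div_iff₀ hDpos] at hv
    linarith
  have hjv : ‖T j v‖ ≤ |C| * ‖v‖ :=
    (T j).le_of_opNorm_le ((hT j).trans (le_abs_self C)) v
  have h₀v : ‖T₀ v‖ ≤ ‖T₀‖ * ‖v‖ := T₀.le_opNorm v
  rw [dist_eq_norm] at hj ⊢
  have hsplit : T j f - T₀ f = (T j w - T₀ w) + T j v - T₀ v := by
    rw [hf j, hf₀, map_add, map_add]
    ring
  rw [hsplit]
  have h₁ := norm_sub_le (T j w - T₀ w + T j v) (T₀ v)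
  have h₂ := norm_add_le (T j w - T₀ w) (T j v)
  nlinarith [norm_nonneg v]

theorem norm_comp_flip_le {F G : Type*} [NormedAddCommGroup F] [NormedSpace ℂ F]
    [NormedAddCommGroup G] [NormedSpace ℂ G] (B : E →L[ℂ] F →L[ℂ] G)
    (m : G →L[ℂ] ℂ) {a : F} {C : ℝ} (ha : ‖a‖ ≤ C) :
    ‖m.comp (B.flip a)‖ ≤ ‖m‖ * (‖B.flip‖ * C) :=
  (m.opNorm_comp_le _).trans (by gcongr; exact B.flip.le_opNorm_of_le ha)

end Separation

theorem apply_eq_of_mem_bidualOf {A : Type*} [NonUnitalNormedRing A] [NormedSpace ℂ A]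
    {J : Submodule ℂ A} {m : (A →L[ℂ] ℂ) →L[ℂ] ℂ} (hm : m ∈ bidualOf A J)
    {f g : A →L[ℂ] ℂ} (h : ∀ a ∈ J, f a = g a) : m f = m g := by
  rw [← sub_eq_zero, ← map_sub]
  exact hm _ fun a ha => by rw [sub_apply, h a ha, sub_self]

/-- Approximating `i*(f)` by `i*(S)` amounts to approximating `f` by `S` in norm, up to a
functional vanishing on `J`. -/
theorem exists_approx_of_mem_closure_iStar {A : Type*} [NonUnitalNormedRing A]
    [NormedSpace ℂ A] {J : Submodule ℂ A} {S : Set (A →L[ℂ] ℂ)}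
    {f : A →L[ℂ] ℂ} (hf : iStar A J f ∈ closure (iStar A J '' S)) {ε : ℝ} (hε : 0 < ε) :
    ∃ w ∈ S, ∃ v : A →L[ℂ] ℂ, ‖v‖ < ε ∧ ∀ a ∈ J, f a = (w + v) a := by
  obtain ⟨_, ⟨w, hw, rfl⟩, hwf⟩ :=
    (Metric.mem_closure_iff (α := ↥J →L[ℂ] ℂ) (s := iStar A J '' S) (a := iStar A J f)).1 hf ε hε
  obtain ⟨v, hv, hvn⟩ := exists_extension_norm_eq J (iStar A J f - iStar A J w)
  have hdist : dist (iStar A J f) (iStar A J w) = ‖iStar A J f - iStar A J w‖ :=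
    dist_eq_norm (E := ↥J →L[ℂ] ℂ) _ _
  refine ⟨w, hw, v, (hvn.trans hdist.symm).trans_lt hwf, fun a ha => ?_⟩
  have hva : v a = f a - w a := hv ⟨a, ha⟩
  rw [add_apply, hva, add_sub_cancel]

section Arens

variable {A : Type*} [NonUnitalNormedRing A] [NormedSpace ℂ A]
  [IsScalarTower ℂ A A] [SMulCommClass ℂ A A]

theorem dArR_apply (φ : A →L[ℂ] ℂ) (a b : A) : dArR A φ a b = φ (a * b) := rfl

theorem dArL_apply (φ : A →L[ℂ] ℂ) (a b : A) : dArL A a φ b = φ (b * a) := rfl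

theorem bdF_apply (m : (A →L[ℂ] ℂ) →L[ℂ] ℂ) (φ : A →L[ℂ] ℂ) (a : A) :
    bdF A m φ a = m (dArR A φ a) := rfl

theorem fBd_apply (m : (A →L[ℂ] ℂ) →L[ℂ] ℂ) (φ : A →L[ℂ] ℂ) (a : A) :
    fBd A φ m a = m (dArL A a φ) := rfl

theorem ar1_apply (m n : (A →L[ℂ] ℂ) →L[ℂ] ℂ) (φ : A →L[ℂ] ℂ) :
    ar1 A m n φ = m (bdF A n φ) := rfl

theorem ar2_apply (m n : (A →L[ℂ] ℂ) →L[ℂ] ℂ) (φ : A →L[ℂ] ℂ) :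
    ar2 A m n φ = n (fBd A φ m) := rfl

theorem IdealInBidual.exists_apply_dArL (h : IdealInBidual A) (m : (A →L[ℂ] ℂ) →L[ℂ] ℂ)
    (a : A) : ∃ c : A, ∀ φ : A →L[ℂ] ℂ, m (dArL A a φ) = φ c := by
  obtain ⟨c, hc⟩ := (h m a).1
  exact ⟨c, fun φ => (DFunLike.congr_fun hc φ).symm⟩

theorem IdealInBidual.exists_apply_dArR (h : IdealInBidual A) (m : (A →L[ℂ] ℂ) →L[ℂ] ℂ)
    (a : A) : ∃ c : A, ∀ φ : A →L[ℂ] ℂ, m (dArR A φ a) = φ c := by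
  obtain ⟨c, hc⟩ := (h m a).2
  exact ⟨c, fun φ => (DFunLike.congr_fun hc φ).symm⟩

/-- In an ideal of its bidual, the two Arens products agree after inserting an element of `A`
between the factors. -/
theorem IdealInBidual.apply_dArL_bdF (h : IdealInBidual A) (m n : (A →L[ℂ] ℂ) →L[ℂ] ℂ)
    (φ : A →L[ℂ] ℂ) (a : A) :
    m (dArL A a (bdF A n φ)) = n (dArR A (fBd A φ m) a) := by
  obtain ⟨c, hc⟩ := h.exists_apply_dArR n a
  have hcφ : dArL A a (bdF A n φ) = dArL A c φ := by
    ext b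
    have hba : dArR A φ (b * a) = dArR A (dArR A φ b) a := by
      ext x
      simp only [dArR_apply, mul_assoc]
    rw [dArL_apply, bdF_apply, hba, hc, dArR_apply, dArL_apply]
  rw [hcφ, hc, fBd_apply]

variable (A) in
/-- The functionals `w` for which `m ↦ m · w` is weak*-to-weak continuous. -/
def weakStarContinuousOrbit : Submodule ℂ (A →L[ℂ] ℂ) where
  carrier := {w | ∀ n : (A →L[ℂ] ℂ) →L[ℂ] ℂ, ∃ ψ : A →L[ℂ] ℂ,
    ∀ m : (A →L[ℂ] ℂ) →L[ℂ] ℂ, n (bdF A m w) = m ψ}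
  zero_mem' n := ⟨0, fun m => by simp [bdF]⟩
  add_mem' {w w'} hw hw' n := by
    obtain ⟨ψ, hψ⟩ := hw n
    obtain ⟨ψ', hψ'⟩ := hw' n
    refine ⟨ψ + ψ', fun m => ?_⟩
    rw [map_add, ← hψ, ← hψ', ← map_add]
    simp [bdF]
  smul_mem' c w hw n := by
    obtain ⟨ψ, hψ⟩ := hw n
    refine ⟨c • ψ, fun m => ?_⟩
    rw [map_smul, ← hψ, ← map_smul]
    simp [bdF]

theorem weakStarContinuousOrbit_subset_WAPset :
    (weakStarContinuousOrbit A : Set (A →L[ℂ] ℂ)) ⊆ WAPset A := by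
  intro w hw
  let G : WeakDual ℂ (A →L[ℂ] ℂ) → WeakSpace ℂ (A →L[ℂ] ℂ) :=
    fun m => toWeakSpace ℂ _ (bdF A (WeakDual.toStrongDual m) w)
  have hG : Continuous G := by
    refine WeakBilin.continuous_of_continuous_eval _ fun n => ?_
    obtain ⟨ψ, hψ⟩ := hw n
    have hev : (fun m => (topDualPairing ℂ (A →L[ℂ] ℂ)).flip (G m) n) =
        fun m : WeakDual ℂ (A →L[ℂ] ℂ) => m ψ := by
      funext m
      exact hψ (WeakDual.toStrongDual m)
    rw [hev]
    exact WeakDual.eval_continuous ψ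
  have hK := (WeakDual.isCompact_closedBall (0 : StrongDual ℂ (A →L[ℂ] ℂ)) 1).image hG
  refine hK.closure_of_subset ?_
  rintro _ ⟨b, hb, rfl⟩
  refine ⟨StrongDual.toWeakDual (ιA A b), ?_, rfl⟩
  rw [mem_closedBall_zero_iff] at hb
  rw [Set.mem_preimage, StrongDual.toStrongDual_toWeakDual, mem_closedBall_zero_iff]
  refine ContinuousLinearMap.opNorm_le_bound _ zero_le_one fun φ => ?_
  calc ‖φ b‖ ≤ ‖φ‖ * ‖b‖ := φ.le_opNorm b
    _ ≤ ‖φ‖ * 1 := by gcongr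
    _ = 1 * ‖φ‖ := by ring

theorem IdealInBidual.dArL_mem_weakStarContinuousOrbit (h : IdealInBidual A) (a : A)
    (φ : A →L[ℂ] ℂ) : dArL A a φ ∈ weakStarContinuousOrbit A := by
  intro n
  refine ⟨dArL A a (fBd A φ n), fun m => ?_⟩
  obtain ⟨c, hc⟩ := h.exists_apply_dArL m a
  have hcφ : bdF A m (dArL A a φ) = dArL A c φ := by
    ext b
    have hba : dArR A (dArL A a φ) b = dArL A a (dArR A φ b) := by
      ext x
      simp only [dArR_apply, dArL_apply, mul_assoc]
    rw [bdF_apply, hba, hc, dArR_apply, dArL_apply]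
  rw [hcφ, hc, fBd_apply]

theorem IdealInBidual.dArR_mem_weakStarContinuousOrbit (h : IdealInBidual A) (a : A)
    (φ : A →L[ℂ] ℂ) : dArR A φ a ∈ weakStarContinuousOrbit A := by
  intro n
  obtain ⟨d, hd⟩ := h.exists_apply_dArR n a
  refine ⟨dArR A φ d, fun m => ?_⟩
  have hm : bdF A m (dArR A φ a) = dArR A (bdF A m φ) a := by
    ext b
    have hab : dArR A (dArR A φ a) b = dArR A φ (a * b) := by
      ext x
      simp only [dArR_apply, mul_assoc]
    rw [bdF_apply, hab, dArR_apply, bdF_apply]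
  rw [hm, hd, bdF_apply]

theorem IdealInBidual.apply_fBd_eq_zero (h : IdealInBidual A) {r : (A →L[ℂ] ℂ) →L[ℂ] ℂ}
    (hr : ∀ φ ∈ WAPset A, r φ = 0) (φ : A →L[ℂ] ℂ) : fBd A φ r = 0 := by
  ext a
  exact hr _ (weakStarContinuousOrbit_subset_WAPset (h.dArL_mem_weakStarContinuousOrbit a φ))

theorem IdealInBidual.apply_bdF_eq_zero (h : IdealInBidual A) {r : (A →L[ℂ] ℂ) →L[ℂ] ℂ}
    (hr : ∀ φ ∈ WAPset A, r φ = 0) (φ : A →L[ℂ] ℂ) : bdF A r φ = 0 := by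
  ext a
  exact hr _ (weakStarContinuousOrbit_subset_WAPset (h.dArR_mem_weakStarContinuousOrbit a φ))

variable (A) in
/-- The linear span of `A · A*`. -/
def leftOrbitSpan : Submodule ℂ (A →L[ℂ] ℂ) :=
  Submodule.span ℂ (Set.range fun p : A × (A →L[ℂ] ℂ) => dArL A p.1 p.2)

theorem dArL_mem_leftOrbitSpan (a : A) (φ : A →L[ℂ] ℂ) : dArL A a φ ∈ leftOrbitSpan A :=
  Submodule.subset_span ⟨(a, φ), rfl⟩

theorem IdealInBidual.leftOrbitSpan_le (h : IdealInBidual A) :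
    leftOrbitSpan A ≤ weakStarContinuousOrbit A := by
  refine Submodule.span_le.2 ?_
  rintro _ ⟨p, rfl⟩
  exact h.dArL_mem_weakStarContinuousOrbit p.1 p.2

/-- On weakly almost periodic functionals, a bounded right approximate identity acts weakly
as an approximate identity. -/
theorem tendsto_apply_dArL_of_mem_WAPset {ι : Type*} (l : Ultrafilter ι) {u : ι → A} {C : ℝ}
    (hC : 0 < C) (hu : ∀ j, ‖u j‖ ≤ C)
    (hright : ∀ a : A, Tendsto (fun j => a * u j) l (𝓝 a))
    {w : A →L[ℂ] ℂ} (hw : w ∈ WAPset A) (m : (A →L[ℂ] ℂ) →L[ℂ] ℂ) :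
    Tendsto (fun j => m (dArL A (u j) w)) l (𝓝 (m w)) := by
  have hC' : (C : ℂ) ≠ 0 := by exact_mod_cast hC.ne'
  let x : ι → WeakSpace ℂ (A →L[ℂ] ℂ) :=
    fun j => toWeakSpace ℂ _ (dArL A ((C : ℂ)⁻¹ • u j) w)
  have hx : ∀ j, x j ∈ closure
      ((fun a : A => (show WeakSpace ℂ (A →L[ℂ] ℂ) from dArL A a w)) ''
        Metric.closedBall 0 1) := by
    refine fun j => subset_closure ⟨(C : ℂ)⁻¹ • u j, ?_, rfl⟩
    rw [mem_closedBall_zero_iff, norm_smul, norm_inv, Complex.norm_real, Real.norm_of_nonneg hC.le,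
      inv_mul_le_iff₀ hC, mul_one]
    exact hu j
  obtain ⟨v, -, hv⟩ := hw.ultrafilter_le_nhds (l.map x)
    (le_principal_iff.2 (Filter.mem_map.2 (Filter.univ_mem' hx)))
  have hlim : ∀ n : (A →L[ℂ] ℂ) →L[ℂ] ℂ,
      Tendsto (fun j => n (dArL A ((C : ℂ)⁻¹ • u j) w)) l (𝓝 (n ((toWeakSpace ℂ _).symm v))) :=
    fun n => ((WeakBilin.eval_continuous (topDualPairing ℂ (A →L[ℂ] ℂ)).flip n).tendsto v).comp hv
  have hsmul : ∀ j, dArL A ((C : ℂ)⁻¹ • u j) w = (C : ℂ)⁻¹ • dArL A (u j) w := by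
    intro j
    ext b
    simp [dArL_apply, mul_smul_comm]
  have hvw : (toWeakSpace ℂ _).symm v = (C : ℂ)⁻¹ • w := by
    ext b
    refine tendsto_nhds_unique (hlim (ιA A b)) ?_
    simp only [hsmul]
    exact ((w.continuous.tendsto b).comp (hright b)).const_smul (C : ℂ)⁻¹
  have hm := (hlim m).const_smul (C : ℂ)
  simp only [hsmul, hvw, map_smul, smul_inv_smul₀ hC'] at hm
  exact hm

theorem WAPset_subset_closure_leftOrbitSpan {ι : Type*} (l : Ultrafilter ι) {u : ι → A} {C : ℝ}
    (hC : 0 < C) (hu : ∀ j, ‖u j‖ ≤ C)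
    (hright : ∀ a : A, Tendsto (fun j => a * u j) l (𝓝 a)) :
    WAPset A ⊆ closure (leftOrbitSpan A : Set (A →L[ℂ] ℂ)) := by
  refine fun w hw => mem_closure_of_forall_annihilator _ w fun r hr => ?_
  refine tendsto_nhds_unique (tendsto_apply_dArL_of_mem_WAPset l hC hu hright hw r) ?_
  simp only [hr _ (dArL_mem_leftOrbitSpan _ w)]
  exact tendsto_const_nhds

/-- On weakly almost periodic functionals, a bounded approximate identity of an ideal in its
bidual acts weakly from the right as an approximate identity. -/
theorem IdealInBidual.tendsto_apply_dArR_of_mem_WAPset (h : IdealInBidual A) {ι : Type*}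
    (l : Ultrafilter ι) {u : ι → A} {C : ℝ} (hC : 0 < C) (hu : ∀ j, ‖u j‖ ≤ C)
    (hright : ∀ a : A, Tendsto (fun j => a * u j) l (𝓝 a))
    (hleft : ∀ a : A, Tendsto (fun j => u j * a) l (𝓝 a))
    {w : A →L[ℂ] ℂ} (hw : w ∈ WAPset A) (m : (A →L[ℂ] ℂ) →L[ℂ] ℂ) :
    Tendsto (fun j => m (dArR A w (u j))) l (𝓝 (m w)) := by
  have hspan : ∀ v ∈ leftOrbitSpan A,
      Tendsto (fun j => m ((dArRL A).flip (u j) v)) l (𝓝 (m v)) := by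
    intro v hv
    induction hv using Submodule.span_induction with
    | mem v hv =>
      obtain ⟨⟨a, φ⟩, rfl⟩ := hv
      obtain ⟨c, hc⟩ := h.exists_apply_dArL m a
      have hcomm : ∀ b, (dArRL A).flip b (dArL A a φ) = dArL A a (dArR A φ b) := by
        intro b
        ext x
        exact congrArg φ (mul_assoc b x a)
      simp only [hcomm, hc, dArR_apply]
      exact (φ.continuous.tendsto c).comp (hleft c)
    | zero => simp
    | add v v' _ _ hv hv' => simpa only [map_add] using hv.add hv'
    | smul c v _ hv => simpa only [map_smul] using hv.const_smul c
  refine tendsto_apply_of_approx (T := fun j => m.comp ((dArRL A).flip (u j))) (T₀ := m)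
    (fun j => norm_comp_flip_le _ m (hu j)) w fun ε hε => ?_
  obtain ⟨v, hv, hvw⟩ := Metric.mem_closure_iff.1
    (WAPset_subset_closure_leftOrbitSpan l hC hu hright hw) ε hε
  refine ⟨v, w - v, hspan v hv, by rwa [← dist_eq_norm], fun j => ?_, ?_⟩ <;>
    rw [add_sub_cancel]

/-- A weak Riesz ideal is Arens regular. -/
theorem WeakRiesz.ar1_eq_ar2 {J : Submodule ℂ A} (hR : WeakRiesz A J) (h : IdealInBidual A)
    (hBAI : HasBAI A) (hJ : IsClosedIdeal A J) {m n : (A →L[ℂ] ℂ) →L[ℂ] ℂ}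
    (hm : m ∈ bidualOf A J) (hn : n ∈ bidualOf A J) : ar1 A m n = ar2 A m n := by
  obtain ⟨ι, l₀, u, hl₀, hbdd, hright₀, hleft₀⟩ := hBAI
  obtain ⟨C, hC, hu⟩ := hbdd.exists_pos_norm_le
  replace hu : ∀ j, ‖u j‖ ≤ C := fun j => hu _ ⟨j, rfl⟩
  let l := Ultrafilter.of l₀
  have hright : ∀ a : A, Tendsto (fun j => a * u j) l (𝓝 a) :=
    fun a => (hright₀ a).mono_left (Ultrafilter.of_le l₀)
  have hleft : ∀ a : A, Tendsto (fun j => u j * a) l (𝓝 a) :=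
    fun a => (hleft₀ a).mono_left (Ultrafilter.of_le l₀)
  ext φ
  have hL : Tendsto (fun j => m (dArL A (u j) (bdF A n φ))) l (𝓝 (m (bdF A n φ))) := by
    refine tendsto_apply_of_approx (T := fun j => m.comp ((dArLL A).flip (u j)))
      (fun j => norm_comp_flip_le _ m (hu j)) _ fun ε hε => ?_
    obtain ⟨w, hw, v, hv, hwv⟩ := exists_approx_of_mem_closure_iStar (hR n hn φ).1 hε
    exact ⟨w, v, tendsto_apply_dArL_of_mem_WAPset l hC hu hright hw m, hv,
      fun j => apply_eq_of_mem_bidualOf hm fun a ha => hwv _ (hJ.2.2 (u j) a ha),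
      apply_eq_of_mem_bidualOf hm hwv⟩
  have hRt : Tendsto (fun j => n (dArR A (fBd A φ m) (u j))) l (𝓝 (n (fBd A φ m))) := by
    refine tendsto_apply_of_approx (T := fun j => n.comp ((dArRL A).flip (u j)))
      (fun j => norm_comp_flip_le _ n (hu j)) _ fun ε hε => ?_
    obtain ⟨w, hw, v, hv, hwv⟩ := exists_approx_of_mem_closure_iStar (hR m hm φ).2 hε
    exact ⟨w, v, h.tendsto_apply_dArR_of_mem_WAPset l hC hu hright hleft hw n, hv,
      fun j => apply_eq_of_mem_bidualOf hn fun a ha => hwv _ (hJ.2.1 (u j) a ha),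
      apply_eq_of_mem_bidualOf hn hwv⟩
  simp only [h.apply_dArL_bdF] at hL
  exact tendsto_nhds_unique hL hRt

theorem weakRiesz_of_forall_wapPerp {J : Submodule ℂ A} (h : IdealInBidual A)
    (hBAI : HasBAI A)
    (hperp : ∀ r ∈ wapPerp A J, ∀ m ∈ bidualOf A J, ar1 A r m = 0 ∧ ar2 A m r = 0) :
    WeakRiesz A J := by
  obtain ⟨ι, l₀, u, hl₀, hbdd, hright₀, -⟩ := hBAI
  obtain ⟨C, hC, hu⟩ := hbdd.exists_pos_norm_le
  have hWAP : WAPset A ⊆ closure (weakStarContinuousOrbit A : Set (A →L[ℂ] ℂ)) :=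
    (WAPset_subset_closure_leftOrbitSpan (Ultrafilter.of l₀) hC (fun j => hu _ ⟨j, rfl⟩)
      fun a => (hright₀ a).mono_left (Ultrafilter.of_le l₀)).trans
      (closure_mono h.leftOrbitSpan_le)
  have key : ∀ f : A →L[ℂ] ℂ, (∀ r ∈ wapPerp A J, r f = 0) →
      iStar A J f ∈ closure (iStar A J '' WAPset A) := by
    intro f hf
    have hmono : (((weakStarContinuousOrbit A).map (iStar A J).toLinearMap :
        Submodule ℂ (↥J →L[ℂ] ℂ)) : Set (↥J →L[ℂ] ℂ)) ⊆ iStar A J '' WAPset A := by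
      rintro _ ⟨w, hw, rfl⟩
      exact ⟨w, weakStarContinuousOrbit_subset_WAPset hw, rfl⟩
    refine closure_mono hmono (mem_closure_of_forall_annihilator (E := ↥J →L[ℂ] ℂ) _ _
      fun r hr => ?_)
    refine hf (r.comp (iStar A J)) ⟨fun φ hφ => ?_, fun φ hφ => ?_⟩
    · have hφ0 : iStar A J φ = 0 := ContinuousLinearMap.ext fun b => hφ b b.2
      rw [ContinuousLinearMap.comp_apply, hφ0, map_zero]
    · have hclosed : IsClosed {ψ : A →L[ℂ] ℂ | (r.comp (iStar A J)) ψ = 0} :=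
        isClosed_eq (r.comp (iStar A J)).continuous continuous_const
      exact closure_minimal (fun ψ hψ => hr _ ⟨ψ, hψ, rfl⟩) hclosed (hWAP hφ)
  exact fun m hm ψ => ⟨key _ fun r hr => DFunLike.congr_fun (hperp r hr m hm).1 ψ,
    key _ fun r hr => DFunLike.congr_fun (hperp r hr m hm).2 ψ⟩

end Arens

/-- Let `A` be a Banach algebra that is a two-sided ideal in its bidual
and has a bounded approximate identity, and let `J` be a closed ideal of `A` (with `J**`
realized inside `A**` as `bidualOf A J` and `i*(WAP(A))^⊥` as `wapPerp A J`).  The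
following are equivalent:
(i) `J` is Arens regular;
(ii) `i*(WAP(A))^⊥ ⊆ Z₁(J**) ∩ Z₂(J**)`;
(iii) `J` is a weak Riesz ideal in `A`;
(iv) `i*(WAP(A))^⊥ · J** = {0}` (first Arens product) and `J** ◊ i*(WAP(A))^⊥ = {0}`
(second Arens product). -/
theorem statement5 (A : Type*) [NonUnitalNormedRing A] [NormedSpace ℂ A]
    [IsScalarTower ℂ A A] [SMulCommClass ℂ A A] [CompleteSpace A]
    (hIdeal : IdealInBidual A) (hBAI : HasBAI A)
    (J : Submodule ℂ A) (hJ : IsClosedIdeal A J) :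
    ((∀ m ∈ bidualOf A J, ∀ n ∈ bidualOf A J, ar1 A m n = ar2 A m n) ↔
      wapPerp A J ⊆ Z1in A (bidualOf A J) ∩ Z2in A (bidualOf A J)) ∧
    ((∀ m ∈ bidualOf A J, ∀ n ∈ bidualOf A J, ar1 A m n = ar2 A m n) ↔
      WeakRiesz A J) ∧
    ((∀ m ∈ bidualOf A J, ∀ n ∈ bidualOf A J, ar1 A m n = ar2 A m n) ↔
      (∀ r ∈ wapPerp A J, ∀ m ∈ bidualOf A J, ar1 A r m = 0 ∧ ar2 A m r = 0)) := by
  have hperp₁ : ∀ r ∈ wapPerp A J, ∀ m, ar2 A r m = 0 := fun r hr m => by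
    ext φ
    rw [ar2_apply, hIdeal.apply_fBd_eq_zero hr.2, map_zero, zero_apply]
  have hperp₂ : ∀ r ∈ wapPerp A J, ∀ m, ar1 A m r = 0 := fun r hr m => by
    ext φ
    rw [ar1_apply, hIdeal.apply_bdF_eq_zero hr.2, map_zero, zero_apply]
  have h12 : (∀ m ∈ bidualOf A J, ∀ n ∈ bidualOf A J, ar1 A m n = ar2 A m n) →
      wapPerp A J ⊆ Z1in A (bidualOf A J) ∩ Z2in A (bidualOf A J) :=
    fun h r hr => ⟨⟨hr.1, fun n hn => h r hr.1 n hn⟩, ⟨hr.1, fun n hn => h n hn r hr.1⟩⟩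
  have h24 : wapPerp A J ⊆ Z1in A (bidualOf A J) ∩ Z2in A (bidualOf A J) →
      ∀ r ∈ wapPerp A J, ∀ m ∈ bidualOf A J, ar1 A r m = 0 ∧ ar2 A m r = 0 :=
    fun h r hr m hm => ⟨((h hr).1.2 m hm).trans (hperp₁ r hr m),
      ((h hr).2.2 m hm).symm.trans (hperp₂ r hr m)⟩
  have h43 : (∀ r ∈ wapPerp A J, ∀ m ∈ bidualOf A J, ar1 A r m = 0 ∧ ar2 A m r = 0) →
      WeakRiesz A J := weakRiesz_of_forall_wapPerp hIdeal hBAI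
  have h31 : WeakRiesz A J →
      ∀ m ∈ bidualOf A J, ∀ n ∈ bidualOf A J, ar1 A m n = ar2 A m n :=
    fun h m hm n hn => h.ar1_eq_ar2 hIdeal hBAI hJ hm hn
  exact ⟨⟨h12, h31 ∘ h43 ∘ h24⟩, ⟨h43 ∘ h24 ∘ h12, h31⟩, ⟨h24 ∘ h12, h31 ∘ h43⟩⟩
end
end

section
/- Let A be a Banach algebra that is a two-sided ideal in its bidual A** and let J be a closed ideal of A. Then: (i) if the linear span of J**·J* is dense in J*, then Z₁(J**) ⊆ Z₁(A**); (ii) if the linear span of J*·J** is dense in J*, then Z₂(J**) ⊆ Z₂(A**); (iii) if the linear span of J**·J*·J** is dense in J*, then Z_i(J**) ⊆ Z_i(A**) for i = 1, 2. -/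
noncomputable section

open Filter Topology

lemma iStar_surjective {A : Type*} [NonUnitalNormedRing A] [NormedSpace ℂ A]
    (J : Submodule ℂ A) : Function.Surjective (iStar A J) := by
  intro ξ
  obtain ⟨φ, hφ, -⟩ := exists_extension_norm_eq J ξ
  exact ⟨φ, ContinuousLinearMap.ext hφ⟩

/-- Two elements of `J**` agree as soon as they agree on a set of functionals whose restrictions
to `J` span a dense subspace of `J*`. -/
lemma eq_of_mem_bidualOf_of_dense {A : Type*} [NonUnitalNormedRing A] [NormedSpace ℂ A]
    {J : Submodule ℂ A} {s t : (A →L[ℂ] ℂ) →L[ℂ] ℂ}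
    (hs : s ∈ bidualOf A J) (ht : t ∈ bidualOf A J) {S : Set (↥J →L[ℂ] ℂ)}
    (hS : Dense (Submodule.span ℂ S : Set (↥J →L[ℂ] ℂ)))
    (hst : ∀ ξ ∈ S, ∃ φ, iStar A J φ = ξ ∧ s φ = t φ) : s = t := by
  have hopen : IsOpenMap (iStar A J) :=
    ContinuousLinearMap.isOpenMap (σ := RingHom.id ℂ) (E := A →L[ℂ] ℂ) (F := ↥J →L[ℂ] ℂ)
      (iStar A J) (iStar_surjective J)
  refine ContinuousLinearMap.coeFn_injective
    (Continuous.ext_on (hS.preimage hopen) s.continuous t.continuous fun φ hφ => ?_)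
  have hspan : Submodule.span ℂ S ≤
      (LinearMap.ker (s - t).toLinearMap).map (iStar A J).toLinearMap := by
    refine Submodule.span_le.2 fun ξ hξ => ?_
    obtain ⟨φ, rfl, h⟩ := hst ξ hξ
    exact ⟨φ, sub_eq_zero.2 h, rfl⟩
  obtain ⟨χ, hχ, hχφ⟩ := hspan hφ
  have hperp : ∀ a ∈ J, (φ - χ) a = 0 := fun a ha =>
    sub_eq_zero.2 (DFunLike.congr_fun hχφ ⟨a, ha⟩).symm
  have h₁ : s φ = s χ := sub_eq_zero.1 ((map_sub s φ χ).symm.trans (hs _ hperp))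
  have h₂ : t φ = t χ := sub_eq_zero.1 ((map_sub t φ χ).symm.trans (ht _ hperp))
  exact h₁.trans ((sub_eq_zero.1 hχ).trans h₂.symm)

section ArensLemmas

variable {A : Type*} [NonUnitalNormedRing A] [NormedSpace ℂ A]
  [IsScalarTower ℂ A A] [SMulCommClass ℂ A A]

lemma dArR_mul (ψ : A →L[ℂ] ℂ) (a b : A) :
    dArR A ψ (a * b) = dArR A (dArR A ψ a) b := by
  ext x
  exact congrArg ψ (mul_assoc a b x)

lemma dArL_mul (ψ : A →L[ℂ] ℂ) (a b : A) :
    dArL A (a * b) ψ = dArL A a (dArL A b ψ) := by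
  ext x
  exact congrArg ψ (mul_assoc x a b).symm

/-- If `A` is an ideal in its bidual, the left and right actions of `A**` on `A*` commute. -/
lemma fBd_bdF_comm (hIdeal : IdealInBidual A) (p m : (A →L[ℂ] ℂ) →L[ℂ] ℂ) (ψ : A →L[ℂ] ℂ) :
    fBd A (bdF A p ψ) m = bdF A p (fBd A ψ m) := by
  ext a
  obtain ⟨c, hc⟩ := (hIdeal p a).2
  have hc_apply (φ : A →L[ℂ] ℂ) : φ c = bdF A p φ a := DFunLike.congr_fun hc φ
  have hact : dArL A a (bdF A p ψ) = dArL A c ψ := by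
    ext b
    calc p (dArR A ψ (b * a)) = p (dArR A (dArR A ψ b) a) := by rw [dArR_mul]
      _ = ψ (b * c) := (hc_apply (dArR A ψ b)).symm
  calc m (dArL A a (bdF A p ψ)) = fBd A ψ m c := congrArg m hact
    _ = bdF A p (fBd A ψ m) a := hc_apply _

/-- Associativity of the first Arens product, in terms of the action on functionals. -/
lemma bdF_ar1 (n p : (A →L[ℂ] ℂ) →L[ℂ] ℂ) (ψ : A →L[ℂ] ℂ) :
    bdF A (ar1 A n p) ψ = bdF A n (bdF A p ψ) := by
  ext a
  change n (bdF A p (dArR A ψ a)) = n (dArR A (bdF A p ψ) a)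
  congr 1
  ext b
  exact congrArg p (dArR_mul ψ a b).symm

/-- Associativity of the second Arens product, in terms of the action on functionals. -/
lemma fBd_ar2 (p n : (A →L[ℂ] ℂ) →L[ℂ] ℂ) (ψ : A →L[ℂ] ℂ) :
    fBd A ψ (ar2 A p n) = fBd A (fBd A ψ p) n := by
  ext a
  change n (fBd A (dArL A a ψ) p) = n (dArL A a (fBd A ψ p))
  congr 1
  ext b
  exact congrArg p (dArL_mul ψ b a).symm

variable {J : Submodule ℂ A}

lemma bdF_eq_zero_of_mem_bidualOf (hJ : IsClosedIdeal A J) {p : (A →L[ℂ] ℂ) →L[ℂ] ℂ}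
    (hp : p ∈ bidualOf A J) {φ : A →L[ℂ] ℂ} (hφ : ∀ a ∈ J, φ a = 0) : bdF A p φ = 0 := by
  ext a
  exact hp (dArR A φ a) fun b hb => hφ _ (hJ.2.1 a b hb)

lemma fBd_eq_zero_of_mem_bidualOf (hJ : IsClosedIdeal A J) {p : (A →L[ℂ] ℂ) →L[ℂ] ℂ}
    (hp : p ∈ bidualOf A J) {φ : A →L[ℂ] ℂ} (hφ : ∀ a ∈ J, φ a = 0) : fBd A φ p = 0 := by
  ext a
  exact hp (dArL A a φ) fun b hb => hφ _ (hJ.2.2 a b hb)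

lemma ar1_mem_bidualOf_right (hJ : IsClosedIdeal A J) (n : (A →L[ℂ] ℂ) →L[ℂ] ℂ)
    {p : (A →L[ℂ] ℂ) →L[ℂ] ℂ} (hp : p ∈ bidualOf A J) : ar1 A n p ∈ bidualOf A J :=
  fun _ hφ => (congrArg n (bdF_eq_zero_of_mem_bidualOf hJ hp hφ)).trans (map_zero n)

lemma ar2_mem_bidualOf_left (hJ : IsClosedIdeal A J) (n : (A →L[ℂ] ℂ) →L[ℂ] ℂ)
    {p : (A →L[ℂ] ℂ) →L[ℂ] ℂ} (hp : p ∈ bidualOf A J) : ar2 A p n ∈ bidualOf A J :=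
  fun _ hφ => (congrArg n (fBd_eq_zero_of_mem_bidualOf hJ hp hφ)).trans (map_zero n)

lemma ar1_mem_bidualOf_left (hJ : IsClosedIdeal A J) (n : (A →L[ℂ] ℂ) →L[ℂ] ℂ)
    {p : (A →L[ℂ] ℂ) →L[ℂ] ℂ} (hp : p ∈ bidualOf A J) : ar1 A p n ∈ bidualOf A J := by
  refine fun φ hφ => hp (bdF A n φ) fun a ha => ?_
  have h0 : dArR A φ a = 0 := by
    ext b
    exact hφ _ (hJ.2.2 b a ha)
  exact (congrArg n h0).trans (map_zero n)

lemma ar2_mem_bidualOf_right (hJ : IsClosedIdeal A J) (n : (A →L[ℂ] ℂ) →L[ℂ] ℂ)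
    {p : (A →L[ℂ] ℂ) →L[ℂ] ℂ} (hp : p ∈ bidualOf A J) : ar2 A n p ∈ bidualOf A J := by
  refine fun φ hφ => hp (fBd A φ n) fun a ha => ?_
  have h0 : dArL A a φ = 0 := by
    ext b
    exact hφ _ (hJ.2.1 b a ha)
  exact (congrArg n h0).trans (map_zero n)

lemma Z1in_bidualOf_subset (hIdeal : IdealInBidual A) (hJ : IsClosedIdeal A J)
    (hd : Dense (↑(Submodule.span ℂ
        {ξ : ↥J →L[ℂ] ℂ | ∃ m ∈ bidualOf A J, ∃ ψ : A →L[ℂ] ℂ,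
          ξ = iStar A J (bdF A m ψ)}) : Set (↥J →L[ℂ] ℂ))) :
    Z1in A (bidualOf A J) ⊆ Z1in A Set.univ := by
  refine fun m hm => ⟨Set.mem_univ m, fun n _ => ?_⟩
  refine eq_of_mem_bidualOf_of_dense (ar1_mem_bidualOf_left hJ n hm.1)
    (ar2_mem_bidualOf_left hJ n hm.1) hd ?_
  rintro ξ ⟨p, hp, ψ, rfl⟩
  refine ⟨_, rfl, ?_⟩
  calc m (bdF A n (bdF A p ψ)) = m (bdF A (ar1 A n p) ψ) := by rw [bdF_ar1]
    _ = n (bdF A p (fBd A ψ m)) :=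
      DFunLike.congr_fun (hm.2 _ (ar1_mem_bidualOf_right hJ n hp)) ψ
    _ = n (fBd A (bdF A p ψ) m) := by rw [fBd_bdF_comm hIdeal]

lemma Z2in_bidualOf_subset (hIdeal : IdealInBidual A) (hJ : IsClosedIdeal A J)
    (hd : Dense (↑(Submodule.span ℂ
        {ξ : ↥J →L[ℂ] ℂ | ∃ m ∈ bidualOf A J, ∃ ψ : A →L[ℂ] ℂ,
          ξ = iStar A J (fBd A ψ m)}) : Set (↥J →L[ℂ] ℂ))) :
    Z2in A (bidualOf A J) ⊆ Z2in A Set.univ := by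
  refine fun m hm => ⟨Set.mem_univ m, fun n _ => ?_⟩
  refine eq_of_mem_bidualOf_of_dense (ar1_mem_bidualOf_right hJ n hm.1)
    (ar2_mem_bidualOf_right hJ n hm.1) hd ?_
  rintro ξ ⟨p, hp, ψ, rfl⟩
  refine ⟨_, rfl, ?_⟩
  calc n (bdF A m (fBd A ψ p)) = n (fBd A (bdF A m ψ) p) := by rw [fBd_bdF_comm hIdeal]
    _ = m (fBd A ψ (ar2 A p n)) :=
      DFunLike.congr_fun (hm.2 _ (ar2_mem_bidualOf_left hJ n hp)) ψ
    _ = m (fBd A (fBd A ψ p) n) := by rw [fBd_ar2]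

end ArensLemmas

/-- Let `A` be a Banach algebra that is a two-sided ideal in its bidual
and let `J` be a closed ideal of `A` (with `J**` realized inside `A**` as `bidualOf A J`,
and `J*` realized as `↥J →L[ℂ] ℂ` via the restriction map `iStar`).  Then:
(i) if the linear span of `J** · J*` is dense in `J*`, then `Z₁(J**) ⊆ Z₁(A**)`;
(ii) if the linear span of `J* · J**` is dense in `J*`, then `Z₂(J**) ⊆ Z₂(A**)`;
(iii) if the linear span of `J** · J* · J**` is dense in `J*`, then
`Z_i(J**) ⊆ Z_i(A**)` for `i = 1, 2`. -/
theorem statement7 (A : Type*) [NonUnitalNormedRing A] [NormedSpace ℂ A]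
    [IsScalarTower ℂ A A] [SMulCommClass ℂ A A] [CompleteSpace A]
    (hIdeal : IdealInBidual A) (J : Submodule ℂ A) (hJ : IsClosedIdeal A J) :
    (Dense (↑(Submodule.span ℂ
        {ξ : ↥J →L[ℂ] ℂ | ∃ m ∈ bidualOf A J, ∃ ψ : A →L[ℂ] ℂ,
          ξ = iStar A J (bdF A m ψ)}) : Set (↥J →L[ℂ] ℂ)) →
      Z1in A (bidualOf A J) ⊆ Z1in A Set.univ) ∧
    (Dense (↑(Submodule.span ℂ
        {ξ : ↥J →L[ℂ] ℂ | ∃ m ∈ bidualOf A J, ∃ ψ : A →L[ℂ] ℂ,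
          ξ = iStar A J (fBd A ψ m)}) : Set (↥J →L[ℂ] ℂ)) →
      Z2in A (bidualOf A J) ⊆ Z2in A Set.univ) ∧
    (Dense (↑(Submodule.span ℂ
        {ξ : ↥J →L[ℂ] ℂ | ∃ m ∈ bidualOf A J, ∃ n ∈ bidualOf A J, ∃ ψ : A →L[ℂ] ℂ,
          ξ = iStar A J (fBd A (bdF A m ψ) n)}) : Set (↥J →L[ℂ] ℂ)) →
      (Z1in A (bidualOf A J) ⊆ Z1in A Set.univ ∧
       Z2in A (bidualOf A J) ⊆ Z2in A Set.univ)) := by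
  refine ⟨Z1in_bidualOf_subset hIdeal hJ, Z2in_bidualOf_subset hIdeal hJ, fun hd =>
    ⟨Z1in_bidualOf_subset hIdeal hJ (hd.mono (Submodule.span_mono ?_)),
      Z2in_bidualOf_subset hIdeal hJ (hd.mono (Submodule.span_mono ?_))⟩⟩
  · rintro ξ ⟨m, hm, n, -, ψ, rfl⟩
    exact ⟨m, hm, fBd A ψ n, by rw [fBd_bdF_comm hIdeal]⟩
  · rintro ξ ⟨m, -, n, hn, ψ, rfl⟩
    exact ⟨n, hn, bdF A m ψ, rfl⟩
end
end
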